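/- Let f : Y → X be a morphism of projective geometrically irreducible varieties over a number field k, where X and Y are realized as closed subvarieties of projective spaces over k, and assume f is finite étale over all of X. Let U ⊆ X be a Zariski open set and let V = f⁻¹(U). If V is xeric, then U is xeric. -/

import Mathlib

noncomputable section

open MvPolynomial
open MvPolynomial

def vecHeight {K : Type} [Field K] [NumberField K] {N : ℕ} (x : Fin N → K) : ℝ :=
  (((FractionalIdeal.absNorm
        (∑ i, FractionalIdeal.spanSingleton
          (nonZeroDivisors (NumberField.RingOfIntegers K)) (x i)) : ℚ) : ℝ)⁻¹ *
      ∏ w : NumberField.InfinitePlace K, (⨆ i, w (x i)) ^ w.mult) ^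
    ((Module.finrank ℚ K : ℝ)⁻¹)

def projHeight {K : Type} [Field K] [NumberField K] {n : ℕ}
    (x : Projectivization K (Fin (n + 1) → K)) : ℝ :=
  vecHeight x.rep

/-! ### Projective zero loci, counting, sparsity -/

/-- The set of `L`-rational points of the Zariski closed subset of `ℙⁿ` cut out by the
set `S` of (homogeneous) polynomials with coefficients in `k`. -/
def projZeroLocus (k : Type) [CommRing k] {n : ℕ} (S : Set (MvPolynomial (Fin (n + 1)) k))
    (L : Type) [Field L] [Algebra k L] : Set (Projectivization L (Fin (n + 1) → L)) :=
  {x | ∀ f ∈ S, eval x.rep (map (algebraMap k L) f) = 0}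

/-- A set `S` of points (of projective space over a number field, say) is *sparse* with
respect to a height function `H` if for every `ε > 0` the number of points of `S` of
height at most `T` is `O_ε(T ^ ε)`. -/
def IsSparseWrt {P : Type} (S : Set P) (H : P → ℝ) : Prop :=
  ∀ ε : ℝ, 0 < ε → ∃ C : ℝ, 0 < C ∧ ∀ T : ℝ, 1 ≤ T →
    {x | x ∈ S ∧ H x ≤ T}.Finite ∧ ({x | x ∈ S ∧ H x ≤ T}.ncard : ℝ) ≤ C * T ^ ε

/-- Sparsity with respect to the standard projective Weil height. -/
def IsSparse {L : Type} [Field L] [NumberField L] {n : ℕ}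
    (S : Set (Projectivization L (Fin (n + 1) → L))) : Prop :=
  IsSparseWrt S projHeight

/-- The closed subset of `ℙⁿ` over a number field `k` cut out by `S` is *xeric* if its set
of `L`-rational points is sparse for every finite extension `L/k`. -/
def IsXeric (k : Type) [Field k] [NumberField k] {n : ℕ}
    (S : Set (MvPolynomial (Fin (n + 1)) k)) : Prop :=
  ∀ (L : Type) [Field L] [NumberField L] [Algebra k L] [FiniteDimensional k L],
    IsSparse (projZeroLocus k S L)

/-! ### Geometric irreducibility and smoothness, via equations -/

/-- The closed subvariety of `ℙⁿ` cut out by `S` is geometrically integral (a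
"geometrically irreducible variety"), expressed over a given algebraically closed
extension `K` of the ground field: the radical of the homogeneous ideal generated by `S`
is prime, and the corresponding cone has a nonzero point. -/
def GeomIntegralOver (k K : Type) [Field k] [Field K] [Algebra k K] {n : ℕ}
    (S : Set (MvPolynomial (Fin (n + 1)) k)) : Prop :=
  (Ideal.span ((map (algebraMap k K)) '' S)).radical.IsPrime ∧
    ∃ x : Fin (n + 1) → K, x ≠ 0 ∧ ∀ f ∈ S, eval x (map (algebraMap k K) f) = 0

/-- Smoothness (of pure dimension `d`) of the closed subvariety of `ℙⁿ` cut out by `S`,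
via the Jacobian criterion: at every nonzero point `x` of the affine cone over an
algebraically closed extension `K`, the space spanned by the gradients of the elements of
the homogeneous ideal of `X` has rank `n - d`. -/
def SmoothOfDimOver (k K : Type) [Field k] [Field K] [Algebra k K] {n : ℕ}
    (S : Set (MvPolynomial (Fin (n + 1)) k)) (d : ℕ) : Prop :=
  ∀ x : Fin (n + 1) → K, x ≠ 0 →
    (∀ f ∈ S, eval x (map (algebraMap k K) f) = 0) →
    Module.finrank K
      (Submodule.span K
        {g : Fin (n + 1) → K |
          ∃ f ∈ Ideal.span ((map (algebraMap k K)) '' S),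
            g = fun j => eval x (pderiv j f)}) = n - d
open MvPolynomial

/-! ### Morphisms of projective varieties, given by finitely many polynomial charts -/

/-- Data describing a morphism from a closed subvariety of `ℙᵐ` to `ℙⁿ`: finitely many
"charts", each of which is an `(n+1)`-tuple of homogeneous polynomials of a common
degree in the `m+1` homogeneous coordinates. -/
structure ChartMap (k : Type) [CommRing k] (m n : ℕ) where
  numCharts : ℕ
  F : Fin numCharts → Fin (n + 1) → MvPolynomial (Fin (m + 1)) k
  deg : Fin numCharts → ℕ
  homog : ∀ c i, (F c i).IsHomogeneous (deg c)

/-- Evaluation of the chart `c` of a `ChartMap` on a coordinate vector with entries in a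
`k`-algebra `A`. -/
def ChartMap.evalVec {k : Type} [CommRing k] {m n : ℕ} (Φ : ChartMap k m n)
    {A : Type} [CommRing A] [Algebra k A] (c : Fin Φ.numCharts) (y : Fin (m + 1) → A) :
    Fin (n + 1) → A :=
  fun i => eval y (map (algebraMap k A) (Φ.F c i))

/-- Base change of the polynomial data of a chart map along `k → K`. -/
def ChartMap.baseChange {k K : Type} [CommRing k] [CommRing K] [Algebra k K] {m n : ℕ}
    (Φ : ChartMap k m n) : ChartMap K m n where
  numCharts := Φ.numCharts
  F := fun c i => map (algebraMap k K) (Φ.F c i)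
  deg := Φ.deg
  homog := fun c i => (Φ.homog c i).map _

/-- The `A`-points of the closed subscheme of `ℙⁿ` cut out by `S`, for a (local)
`k`-algebra `A`, described by coordinate vectors: vectors, one of whose coordinates is a
unit, on which all the equations vanish.  (Two such vectors describe the same `A`-point
iff they differ by a unit scalar, see `unitEquiv`.) -/
def ringPoints (k : Type) [CommRing k] {n : ℕ} (S : Set (MvPolynomial (Fin (n + 1)) k))
    (A : Type) [CommRing A] [Algebra k A] : Set (Fin (n + 1) → A) :=
  {a | (∃ i, IsUnit (a i)) ∧ ∀ f ∈ S, eval a (map (algebraMap k A) f) = 0}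

/-- Two coordinate vectors describe the same point iff they differ by a unit scalar. -/
def unitEquiv {A : Type} [CommRing A] {N : ℕ} (a b : Fin N → A) : Prop :=
  ∃ u : Aˣ, b = fun i => (u : A) * a i

/-- The property that the chart data `Φ` defines a morphism from the closed subvariety
`Y ⊆ ℙᵐ` cut out by `SY` to the closed subvariety `X ⊆ ℙⁿ` cut out by `SX`:  on the
points of `Y` with values in any local `k`-algebra `A`, some chart is defined (has a unit
coordinate), any two defined charts agree up to a unit scalar, and the image satisfies
the equations of `X`.  (The functor of points on local rings determines a morphism of
  schemes, and every morphism of quasi-projective varieties arises this way.) -/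
structure IsChartMorphism (k : Type) [Field k] {m n : ℕ} (Φ : ChartMap k m n)
    (SY : Set (MvPolynomial (Fin (m + 1)) k)) (SX : Set (MvPolynomial (Fin (n + 1)) k)) :
    Prop where
  total : ∀ (A : Type) [CommRing A] [IsLocalRing A] [Algebra k A],
    ∀ a ∈ ringPoints k SY A, ∃ c i, IsUnit (Φ.evalVec c a i)
  compat : ∀ (A : Type) [CommRing A] [IsLocalRing A] [Algebra k A],
    ∀ a ∈ ringPoints k SY A, ∀ c c', (∃ i, IsUnit (Φ.evalVec c a i)) →
      (∃ i, IsUnit (Φ.evalVec c' a i)) → unitEquiv (Φ.evalVec c a) (Φ.evalVec c' a)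
  mapsInto : ∀ (A : Type) [CommRing A] [IsLocalRing A] [Algebra k A],
    ∀ a ∈ ringPoints k SY A, ∀ c, (∃ i, IsUnit (Φ.evalVec c a i)) →
      Φ.evalVec c a ∈ ringPoints k SX A

/-- The graph of the map induced by the chart data `Φ` on projective points over a field
`L`: `z` is the image of `x` if some chart of `Φ` is nonzero at (a representative of) `x`
and `z` is the corresponding projective point. -/
def chartImage {k L : Type} [Field k] [Field L] [Algebra k L] {m n : ℕ}
    (Φ : ChartMap k m n) (x : Projectivization L (Fin (m + 1) → L))
    (z : Projectivization L (Fin (n + 1) → L)) : Prop :=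
  ∃ c, ∃ h : Φ.evalVec c x.rep ≠ 0, z = Projectivization.mk L (Φ.evalVec c x.rep) h

/-! ### Finite étale morphisms, concretely -/

/-- The set of coordinate vectors of `A`-points of `Y` lying (up to a unit scalar, as
they must) over the `A`-point of `X` with coordinate vector `b`, under the map given by
the chart data `Φ`. -/
def fiberOver (k : Type) [Field k] {m n : ℕ} (Φ : ChartMap k m n)
    (SY : Set (MvPolynomial (Fin (m + 1)) k)) (A : Type) [CommRing A] [Algebra k A]
    (b : Fin (n + 1) → A) : Set (Fin (m + 1) → A) :=
  {a | a ∈ ringPoints k SY A ∧ ∃ c, (∃ i, IsUnit (Φ.evalVec c a i)) ∧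
    unitEquiv (Φ.evalVec c a) b}

/-- A set of coordinate vectors contains exactly `d` points up to unit scaling. -/
def HasExactlyPoints {A : Type} [CommRing A] {N : ℕ} (s : Set (Fin N → A)) (d : ℕ) :
    Prop :=
  ∃ r : Fin d → (Fin N → A), (∀ j, r j ∈ s) ∧
    (∀ j j', unitEquiv (r j) (r j') → j = j') ∧ ∀ a ∈ s, ∃ j, unitEquiv a (r j)

/-- The morphism `Y → X` given by the chart data `Φ` is finite étale of degree `d`:
over every point of `X` with values in a local Artinian `k`-algebra with algebraically
closed residue field, the fiber consists of exactly `d` points.  (For a morphism of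
projective varieties over a field of characteristic `0` this characterizes finite étale
morphisms of degree `d`.) -/
def IsFiniteEtaleOfDegree (k : Type) [Field k] {m n : ℕ} (Φ : ChartMap k m n)
    (SY : Set (MvPolynomial (Fin (m + 1)) k)) (SX : Set (MvPolynomial (Fin (n + 1)) k))
    (d : ℕ) : Prop :=
  ∀ (A : Type) [CommRing A] [IsLocalRing A] [IsArtinianRing A] [Algebra k A],
    IsAlgClosed (IsLocalRing.ResidueField A) →
    ∀ b ∈ ringPoints k SX A, HasExactlyPoints (fiberOver k Φ SY A b) d

/-- Finite étale (of some positive degree). -/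
def IsFiniteEtaleMor (k : Type) [Field k] {m n : ℕ} (Φ : ChartMap k m n)
    (SY : Set (MvPolynomial (Fin (m + 1)) k)) (SX : Set (MvPolynomial (Fin (n + 1)) k)) :
    Prop :=
  ∃ d : ℕ, 0 < d ∧ IsFiniteEtaleOfDegree k Φ SY SX d

/-! ### Rational curves -/

/-- Data for a morphism `ℙ¹ → ℙⁿ`: an `(n+1)`-tuple of binary forms of a common degree. -/
structure RatCurveData (K : Type) [CommRing K] (n : ℕ) where
  d : ℕ
  P : Fin (n + 1) → MvPolynomial (Fin 2) K
  homog : ∀ i, (P i).IsHomogeneous d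

/-- Evaluation of the tuple of binary forms at `(s, t)`. -/
def RatCurveData.evalAt {K : Type} [CommRing K] {n : ℕ} (Γ : RatCurveData K n)
    (s t : K) : Fin (n + 1) → K :=
  fun i => eval ![s, t] (Γ.P i)

/-- A subset `C` of `ℙⁿ(K)`, `K` algebraically closed, is a (possibly singular) rational
curve if it is the image of a non-constant morphism `ℙ¹ → ℙⁿ` (such an image is
automatically an integral closed curve). -/
def IsRationalCurve (K : Type) [Field K] {n : ℕ}
    (C : Set (Projectivization K (Fin (n + 1) → K))) : Prop :=
  ∃ Γ : RatCurveData K n,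
    (∀ s t : K, ¬(s = 0 ∧ t = 0) → Γ.evalAt s t ≠ 0) ∧
    (∃ s t s' t' : K, ¬(s = 0 ∧ t = 0) ∧ ¬(s' = 0 ∧ t' = 0) ∧
      ∀ u : K, Γ.evalAt s' t' ≠ u • Γ.evalAt s t) ∧
    C = {z | ∃ s t : K, ∃ h : Γ.evalAt s t ≠ 0, z = Projectivization.mk K (Γ.evalAt s t) h}

theorem exists_smul_mem_span_of_span_eq_top {R K s ι : Type*} [CommRing R] [Field K]
    [Fintype s] (φ : R →+* K) (v : ι → s → R)
    (h : Submodule.span K (Set.range fun i j => φ (v i j)) = ⊤) :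
    ∃ g : R, φ g ≠ 0 ∧ ∀ w : s → R, g • w ∈ Submodule.span R (Set.range v) := by
  classical
  let b := Module.Basis.ofSpan (K := K) (s := Set.range fun i j => φ (v i j)) h.ge
  have hb : ∀ x, b x ∈ Set.range fun i j => φ (v i j) := fun x =>
    Module.Basis.ofSpan_subset h.ge ⟨x, rfl⟩
  let e := b.indexEquiv (Pi.basisFun K s)
  let b' := b.reindex e
  have hb' : ∀ j, ∃ i, (fun a => φ (v i a)) = b' j := fun j => by
    simpa [b'] using hb (e.symm j)
  choose i hi using hb'
  let M : Matrix s s R := Matrix.of fun j a => v (i j) a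
  refine ⟨M.det, ?_, fun w => ?_⟩
  · have : φ M.det = (M.map φ).det := by simp [RingHom.map_det]
    rw [this, ← isUnit_iff_ne_zero, ← Matrix.isUnit_iff_isUnit_det,
      ← Matrix.linearIndependent_rows_iff_isUnit]
    have h2 : (M.map φ).row = b' := by
      funext j; rw [← hi]; rfl
    rw [h2]
    exact b'.linearIndependent
  · have : M.det • w = ∑ j, (Matrix.vecMul w M.adjugate j) • v (i j) := by
      have h1 : Matrix.vecMul w (M.adjugate * M) = M.det • w := by
        rw [Matrix.adjugate_mul, Matrix.vecMul_smul, Matrix.vecMul_one]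
      rw [← h1, ← Matrix.vecMul_vecMul, Matrix.vecMul_eq_sum]
      rfl
    rw [this]
    exact Submodule.sum_mem _ fun j _ => Submodule.smul_mem _ _ (Submodule.subset_span ⟨_, rfl⟩)

theorem ValuationSubring.mem_of_isIntegral_int {K : Type*} [Field K] (V : ValuationSubring K)
    {x : K} (hx : IsIntegral ℤ x) : x ∈ V := by
  have : IsIntegral V x := hx.tower_top
  obtain ⟨y, rfl⟩ := IsIntegrallyClosed.isIntegral_iff.mp this
  exact y.2

theorem MvPolynomial.exists_int_mul_eval_mem {σ K : Type*} [Field K] [CharZero K]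
    [Algebra.IsAlgebraic ℚ K] {N : ℤ} (hN : N ≠ 0) (p : MvPolynomial σ K) :
    ∃ M : ℤ, M ≠ 0 ∧ ∀ (V : ValuationSubring K) (x : σ → K), (∀ i, (N : K) * x i ∈ V) →
      (M : K) * eval x p ∈ V := by
  have int_mem : ∀ (V : ValuationSubring K) (a : ℤ), (a : K) ∈ V := fun V a => by simp
  induction p using MvPolynomial.induction_on with
  | C a =>
    have ha : IsAlgebraic ℤ a :=
      (IsFractionRing.isAlgebraic_iff ℤ ℚ K).mpr (Algebra.IsAlgebraic.isAlgebraic a)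
    obtain ⟨M, hM, h⟩ := ha.exists_integral_multiple
    refine ⟨M, hM, fun V x _ => ?_⟩
    simpa using V.mem_of_isIntegral_int h
  | add p q hp hq =>
    obtain ⟨M, hM, h⟩ := hp
    obtain ⟨M', hM', h'⟩ := hq
    refine ⟨M * M', mul_ne_zero hM hM', fun V x hx => ?_⟩
    have : ((M * M' : ℤ) : K) * eval x (p + q) =
        M' * (M * eval x p) + M * (M' * eval x q) := by push_cast; simp; ring
    rw [this]
    exact add_mem (mul_mem (int_mem V _) (h V x hx)) (mul_mem (int_mem V _) (h' V x hx))
  | mul_X p i hp =>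
    obtain ⟨M, hM, h⟩ := hp
    refine ⟨M * N, mul_ne_zero hM hN, fun V x hx => ?_⟩
    have : ((M * N : ℤ) : K) * eval x (p * X i) = (M * eval x p) * (N * x i) := by
      push_cast; simp; ring
    rw [this]
    exact mul_mem (h V x hx) (hx i)

/-- Among finitely many specializations `t` of the parameter, one of them makes the values of the
linear form `∑ b, t ^ b * Y b` at a bounded number of vectors as large as possible, with respect
to an arbitrary valuation and up to a uniform constant. -/
theorem exists_int_forall_exists_moment_form_bound (m d : ℕ) : ∃ M : ℤ, M ≠ 0 ∧
    ∀ (K : Type) [Field K] [CharZero K] (V : ValuationSubring K) (ι : Type) [Fintype ι]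
      (_ : Fintype.card ι ≤ d) (u : ι → Fin (m + 1) → K),
      ∃ t ∈ Finset.range (m * d + 1), ∀ i a, ∃ c ∈ V,
        (M : K) * u i a = c * ∑ b : Fin (m + 1), (t : K) ^ (b : ℕ) * u i b := by
  classical
  let W : (Fin (m + 1) → Fin (m * d + 1)) → Matrix (Fin (m + 1)) (Fin (m + 1)) ℤ :=
    fun f => Matrix.vandermonde fun j => ((f j : ℕ) : ℤ)
  let D : Finset (Fin (m + 1) → Fin (m * d + 1)) := Finset.univ.filter Function.Injective
  refine ⟨∏ f ∈ D, (W f).det, ?_, ?_⟩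
  · refine Finset.prod_ne_zero_iff.mpr fun f hf => ?_
    have hf' : Function.Injective f := by simpa [D] using hf
    refine Matrix.det_vandermonde_ne_zero_iff.mpr fun i j hij => hf' ?_
    have : ((f i : ℕ) : ℤ) = (f j : ℕ) := hij
    exact Fin.ext (by exact_mod_cast this)
  intro K _ _ V ι _ hι u
  by_contra! hcon
  have int_mem : ∀ (a : ℤ), (a : K) ∈ V := fun a => by simp
  have hbad : ∀ t : Fin (m * d + 1), ∃ i a, ∀ c ∈ V,
      ((∏ f ∈ D, (W f).det : ℤ) : K) * u i a ≠
        c * ∑ b : Fin (m + 1), ((t : ℕ) : K) ^ (b : ℕ) * u i b := fun t =>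
    hcon t (Finset.mem_range.mpr t.2)
  choose i a hia using hbad
  obtain ⟨i₀, hi₀⟩ := Fintype.exists_lt_card_fiber_of_mul_lt_card (f := i) (n := m) (by
    rw [Fintype.card_fin]
    calc Fintype.card ι * m ≤ d * m := Nat.mul_le_mul_right _ hι
      _ = m * d := mul_comm _ _
      _ < _ := Nat.lt_succ_self _)
  obtain ⟨S, hS, hcard⟩ := Finset.exists_subset_card_eq (Nat.succ_le_of_lt hi₀)
  let f : Fin (m + 1) → Fin (m * d + 1) := fun j => S.orderEmbOfFin hcard j
  have hf : Function.Injective f := (S.orderEmbOfFin hcard).injective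
  have hfD : f ∈ D := by simp [D, hf]
  have hfi : ∀ j, i (f j) = i₀ := fun j => by
    have := hS (S.orderEmbOfFin_mem hcard j)
    simpa using this
  let L : Fin (m + 1) → K := fun j => ∑ b : Fin (m + 1), ((f j : ℕ) : K) ^ (b : ℕ) * u i₀ b
  have hL : L = Matrix.mulVec ((W f).map (Int.castRingHom K)) (u i₀) := by
    funext j; simp [L, W, Matrix.mulVec, dotProduct, Matrix.vandermonde]
  have key : ∀ a, ((W f).det : K) * u i₀ a =
      ∑ j, (((W f).adjugate a j : ℤ) : K) * L j := fun a => by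
    have h1 : Matrix.mulVec ((W f).adjugate.map (Int.castRingHom K)) L
        = ((W f).det : K) • u i₀ := by
      have h2 : ((W f).det • (1 : Matrix (Fin (m + 1)) (Fin (m + 1)) ℤ)).map (Int.castRingHom K)
          = ((W f).det : K) • 1 := by
        ext a b
        simp only [Matrix.map_apply, Matrix.smul_apply, Matrix.one_apply]
        split_ifs <;> simp
      rw [hL, Matrix.mulVec_mulVec, ← Matrix.map_mul, Matrix.adjugate_mul, h2, Matrix.smul_mulVec,
        Matrix.one_mulVec]
    have := congrFun h1 a
    simp only [Pi.smul_apply, smul_eq_mul] at this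
    rw [← this]
    simp [Matrix.mulVec, dotProduct]
  obtain ⟨j₀, -, hj₀⟩ := Finset.exists_max_image Finset.univ (fun j => V.valuation (L j))
    Finset.univ_nonempty
  have hdiv : ∀ j, ∃ c ∈ V, L j = c * L j₀ := fun j => by
    by_cases h0 : L j₀ = 0
    · have := hj₀ j (Finset.mem_univ _)
      rw [h0, map_zero, le_zero_iff, map_eq_zero] at this
      exact ⟨0, V.zero_mem, by simp [this]⟩
    · refine ⟨L j / L j₀, ?_, by field_simp⟩
      rw [← V.valuation_le_one_iff, map_div₀]
      exact div_le_one_of_le₀ (hj₀ j (Finset.mem_univ _)) zero_le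
  choose c hc hcL using hdiv
  refine hia (f j₀) ((((∏ g ∈ D.erase f, (W g).det : ℤ) : K)) *
    ∑ j, (((W f).adjugate (a (f j₀)) j : ℤ) : K) * c j) ?_ ?_
  · exact mul_mem (int_mem _) (sum_mem fun j _ => mul_mem (int_mem _) (hc j))
  · rw [hfi, ← Finset.mul_prod_erase D _ hfD]
    rw [Int.cast_mul, mul_comm ((W f).det : K), mul_assoc, key, mul_assoc]
    congr 1
    rw [Finset.sum_mul]
    refine Finset.sum_congr rfl fun j _ => ?_
    rw [hcL j, mul_assoc]

section RamificationBound

open NumberField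

theorem NumberField.exists_mul_eq_of_mem_valuationSubring {F K : Type*} [Field F] [NumberField F]
    [Field K] (f : F →+* K) (V : ValuationSubring K) (z : F) (hz : f z ∈ V) :
    ∃ q r : 𝓞 F, f q ≠ 0 ∧ (f q)⁻¹ ∈ V ∧ (r : F) = q * z := by
  have int_mem : ∀ a : 𝓞 F, f a ∈ V := fun a =>
    V.mem_of_isIntegral_int ((RingOfIntegers.isIntegral_coe a).map (f.toIntAlgHom))
  let I : FractionalIdeal (nonZeroDivisors (𝓞 F)) F :=
    FractionalIdeal.spanSingleton _ 1 + FractionalIdeal.spanSingleton _ z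
  have h1I : (1 : F) ∈ I := (FractionalIdeal.mem_add _ _ _).mpr
    ⟨1, FractionalIdeal.mem_spanSingleton_self _ _, 0, FractionalIdeal.zero_mem _, by simp⟩
  have hzI : z ∈ I := (FractionalIdeal.mem_add _ _ _).mpr
    ⟨0, FractionalIdeal.zero_mem _, z, FractionalIdeal.mem_spanSingleton_self _ _, by simp⟩
  have hI : I ≠ 0 := fun h => one_ne_zero ((FractionalIdeal.mem_zero_iff _).mp (h ▸ h1I))
  have hmul : I * I⁻¹ = 1 := mul_inv_cancel₀ hI
  have hcl : ∀ a ∈ I⁻¹, ∀ w ∈ I, ∃ r : 𝓞 F, (r : F) = a * w := fun a ha w hw => by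
    have : w * a ∈ I * I⁻¹ := FractionalIdeal.mul_mem_mul hw ha
    rw [hmul, FractionalIdeal.mem_one_iff] at this
    obtain ⟨r, hr⟩ := this
    exact ⟨r, by rw [mul_comm]; exact hr⟩
  have h1 : (1 : F) ∈ I * I⁻¹ := by rw [hmul]; exact FractionalIdeal.one_mem_one _
  rw [add_mul, FractionalIdeal.mem_add] at h1
  obtain ⟨x, hx, y, hy, hxy⟩ := h1
  rw [FractionalIdeal.mem_singleton_mul] at hx hy
  obtain ⟨β, hβ, rfl⟩ := hx
  obtain ⟨α, hα, rfl⟩ := hy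
  obtain ⟨b, hb⟩ := hcl β hβ 1 h1I
  obtain ⟨bz, hbz⟩ := hcl β hβ z hzI
  obtain ⟨a, ha⟩ := hcl α hα 1 h1I
  obtain ⟨az, haz⟩ := hcl α hα z hzI
  rw [mul_one] at hb ha
  have hsum : f b + f az = 1 := by
    rw [hb, haz, ← map_add, mul_comm α z, ← one_mul β, hxy, map_one]
  have hunit : ∀ (w : F) (hw : f w ∈ V), IsUnit (⟨f w, hw⟩ : V) → f w ≠ 0 ∧ (f w)⁻¹ ∈ V := by
    intro w hw h
    obtain ⟨u, hu⟩ := isUnit_iff_exists_inv.mp h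
    have hu' : f w * (u : K) = 1 := congrArg Subtype.val hu
    refine ⟨left_ne_zero_of_mul_eq_one hu', ?_⟩
    rw [← eq_inv_of_mul_eq_one_right hu']
    exact u.2
  rcases IsLocalRing.isUnit_or_isUnit_of_add_one
    (a := (⟨f b, int_mem b⟩ : V)) (b := ⟨f az, int_mem az⟩) (Subtype.ext hsum) with h | h
  · obtain ⟨h0, h1⟩ := hunit _ _ h
    exact ⟨b, bz, h0, h1, by rw [hb, hbz]⟩
  · obtain ⟨h0, h1⟩ := hunit _ _ h
    have e : f az = f a * f z := by rw [ha, haz, map_mul]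
    refine ⟨a, az, fun h => h0 (by rw [e, h, zero_mul]), ?_, by rw [ha, haz]⟩
    have hz0 : f z ≠ 0 := fun h => h0 (by rw [e, h, mul_zero])
    have : (f a)⁻¹ = f z * (f az)⁻¹ := by rw [e, mul_inv]; field_simp
    rw [this]
    exact mul_mem hz h1

/-- An element of a number field all of whose conjugates lie in a valuation ring becomes integral
after multiplication by an integer of the base field which is a unit of the valuation ring. -/
theorem NumberField.exists_isIntegral_mul_of_forall_algHom_mem {L E K : Type*} [Field L]
    [NumberField L] [Field E] [NumberField E] [Algebra L E] [Field K] [Algebra L K]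
    [IsAlgClosed K] (V : ValuationSubring K) (θ : E) (hθ : ∀ σ : E →ₐ[L] K, σ θ ∈ V) :
    ∃ b : 𝓞 L, algebraMap L K b ≠ 0 ∧ (algebraMap L K b)⁻¹ ∈ V ∧
      IsIntegral ℤ (algebraMap L E b * θ) := by
  classical
  have : FiniteDimensional L E := Module.Finite.of_restrictScalars_finite ℚ L E
  have h_integral : IsIntegral L θ := Algebra.IsIntegral.isIntegral θ
  set p := minpoly L θ with hp
  have hmonic : p.Monic := minpoly.monic h_integral
  have hcoeff : ∀ i, algebraMap L K (p.coeff i) ∈ V := by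
    have hs : (p.map (algebraMap L K)).Splits := IsAlgClosed.splits _
    have hpl : p.map (algebraMap L K) ∈ Polynomial.lifts V.subtype := by
      rw [hs.eq_prod_roots_of_monic (hmonic.map _)]
      refine Submonoid.multiset_prod_mem (Polynomial.lifts V.subtype).toSubmonoid _ ?_
      intro g hg
      obtain ⟨r, hr, rfl⟩ := Multiset.mem_map.mp hg
      have hr' : r ∈ p.rootSet K := by
        rw [Polynomial.rootSet, Polynomial.aroots]
        simpa using hr
      rw [hp, ← Algebra.IsAlgebraic.range_eval_eq_rootSet_minpoly_of_splits K
        (fun x => IsAlgClosed.splits _)] at hr'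
      obtain ⟨σ, rfl⟩ := hr'
      exact ⟨Polynomial.X - Polynomial.C ⟨σ θ, hθ σ⟩, by simp⟩
    intro i
    obtain ⟨x, hx⟩ := (Polynomial.lifts_iff_coeff_lifts _).mp hpl i
    rw [Polynomial.coeff_map] at hx
    rw [← hx]
    exact x.2
  choose q r hq hqV hr using fun i =>
    exists_mul_eq_of_mem_valuationSubring (algebraMap L K) V (p.coeff i) (hcoeff i)
  let b : 𝓞 L := ∏ i ∈ Finset.range p.natDegree, q i
  have hbi : ∀ i < p.natDegree, ∃ s : 𝓞 L, (s : L) = p.coeff i * b := by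
    intro i hi
    refine ⟨r i * ∏ j ∈ (Finset.range p.natDegree).erase i, q j, ?_⟩
    simp only [b, ← Finset.mul_prod_erase _ q (Finset.mem_range.mpr hi), map_mul, hr]
    ring
  refine ⟨b, ?_, ?_, ?_⟩
  · simp only [b, map_prod]
    exact Finset.prod_ne_zero_iff.mpr fun i _ => hq i
  · simp only [b, map_prod, ← Finset.prod_inv_distrib]
    exact prod_mem fun i _ => hqV i
  · have h0 : Polynomial.aeval (algebraMap L E b * θ) (p.scaleRoots (b : L)) = 0 :=
      Polynomial.scaleRoots_aeval_eq_zero (minpoly.aeval L θ)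
    have hlift : p.scaleRoots (b : L) ∈ Polynomial.lifts (algebraMap (𝓞 L) L) := by
      rw [Polynomial.lifts_iff_coeff_lifts]
      intro i
      rw [Polynomial.coeff_scaleRoots]
      rcases lt_trichotomy i p.natDegree with h | h | h
      · obtain ⟨s, hs⟩ := hbi i h
        refine ⟨s * b ^ (p.natDegree - i - 1), ?_⟩
        rw [map_mul, map_pow]
        change (s : L) * (b : L) ^ (p.natDegree - i - 1) = _
        rw [hs, mul_assoc, ← pow_succ']
        congr 2
        omega
      · subst h
        exact ⟨1, by simp [hmonic.coeff_natDegree]⟩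
      · exact ⟨0, by simp [Polynomial.coeff_eq_zero_of_natDegree_lt h]⟩
    obtain ⟨P, hP, -, hPm⟩ := Polynomial.lifts_and_natDegree_eq_and_monic hlift
      ((Polynomial.monic_scaleRoots_iff _).mpr hmonic)
    have : IsIntegral (𝓞 L) (algebraMap L E b * θ) := by
      refine ⟨P, hPm, ?_⟩
      rw [← hP, Polynomial.aeval_def, Polynomial.eval₂_map] at h0
      exact h0
    exact isIntegral_trans _ this

/-- If, locally at every place, a number field `E` has an element whose conjugates are integral and
differ from one of them by divisors of the integer `M`, then a power of `M` lies in the different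
of `E`. -/
theorem NumberField.intCast_pow_mem_differentIdeal {L E K : Type*} [Field L]
    [NumberField L] [Field E] [NumberField E] [Algebra L E] [Field K] [Algebra L K]
    [IsAlgClosed K] (φ : E →ₐ[L] K) {M : ℤ} (hM : M ≠ 0)
    (h : ∀ V : ValuationSubring K, ∃ θ : E, (∀ σ : E →ₐ[L] K, σ θ ∈ V) ∧
      ∀ σ : E →ₐ[L] K, σ ≠ φ → ∃ c ∈ V, (M : K) = c * (φ θ - σ θ)) :
    (M : 𝓞 E) ^ Module.finrank L E ∈ differentIdeal (𝓞 L) (𝓞 E) := by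
  classical
  have : FiniteDimensional L E := Module.Finite.of_restrictScalars_finite ℚ L E
  have hchar : CharZero K := charZero_of_injective_algebraMap (algebraMap L K).injective
  have hMK : (M : K) ≠ 0 := by exact_mod_cast hM
  by_contra hcon
  set D := differentIdeal (𝓞 L) (𝓞 E) with hD
  let ψ : 𝓞 E →+* K := φ.toRingHom.comp (algebraMap (𝓞 E) E)
  have hψ : Function.Injective ψ := φ.toRingHom.injective.comp RingOfIntegers.coe_injective
  let e : 𝓞 E ≃+* ψ.range := RingEquiv.ofBijective ψ.rangeRestrict
    ⟨fun a b hab => hψ (congrArg Subtype.val hab), ψ.rangeRestrict_surjective⟩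
  let c : Ideal (𝓞 E) := D.colon {(M : 𝓞 E) ^ Module.finrank L E}
  have hmem : ∀ b, b ∈ c ↔ b * (M : 𝓞 E) ^ Module.finrank L E ∈ D := fun b => by
    simp [c, Submodule.mem_colon_singleton]
  have hc : c.comap (e.symm : ψ.range →+* 𝓞 E) ≠ ⊤ := by
    intro htop
    have h1 := (Ideal.eq_top_iff_one _).mp htop
    rw [Ideal.mem_comap, map_one, hmem, one_mul] at h1
    exact hcon h1
  obtain ⟨V, hVA, hVc⟩ := Ideal.image_subset_nonunits_valuationSubring _ hc
  have hunit : ∀ q ∈ c, ψ q ≠ 0 → (ψ q)⁻¹ ∉ V := by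
    intro q hq hq0 hinv
    have : ψ q ∈ V.nonunits := hVc ⟨e q, by simpa using hq, rfl⟩
    rcases V.mem_nonunits_iff_exists_mem_maximalIdeal.mp this with ⟨hqV, hmax⟩
    refine (IsLocalRing.mem_maximalIdeal _).mp hmax (IsUnit.of_mul_eq_one (⟨_, hinv⟩ : V) ?_)
    exact Subtype.ext (mul_inv_cancel₀ hq0)
  obtain ⟨θ, hθ, hθM⟩ := h V
  obtain ⟨b, hb0, hbV, hbint⟩ := exists_isIntegral_mul_of_forall_algHom_mem V θ hθ
  let x : 𝓞 E := ⟨algebraMap L E b * θ, hbint⟩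
  have hx : (x : E) = algebraMap L E b * θ := rfl
  have hσx : ∀ σ : E →ₐ[L] K, σ x = algebraMap L K b * σ θ := fun σ => by
    rw [hx, map_mul, σ.commutes]
  have hxM : ∀ σ : E →ₐ[L] K, σ ≠ φ → ∃ c ∈ V, (M : K) = c * (φ x - σ x) := by
    intro σ hσ
    obtain ⟨c, hc, hcM⟩ := hθM σ hσ
    refine ⟨c * (algebraMap L K b)⁻¹, mul_mem hc hbV, ?_⟩
    rw [hcM, hσx, hσx, ← mul_sub]
    field_simp
  have hne : ∀ σ : E →ₐ[L] K, σ x = φ x → σ = φ := by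
    intro σ hσ
    by_contra hne
    obtain ⟨c, -, hc⟩ := hxM σ hne
    rw [hσ, sub_self, mul_zero] at hc
    exact hMK hc
  have hprim : IntermediateField.adjoin L {(x : E)} = ⊤ :=
    (Field.primitive_element_iff_algHom_eq_of_eval L K (fun x => IsAlgClosed.splits _) _ φ).mpr
      fun σ hσ => (hne σ hσ.symm).symm
  have hintx : IsIntegral L (x : E) := Algebra.IsIntegral.isIntegral _
  have hadj : Algebra.adjoin L {(x : E)} = ⊤ := by
    rw [← IntermediateField.adjoin_simple_toSubalgebra_of_isAlgebraic hintx.isAlgebraic, hprim]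
    rfl
  have hdiff := aeval_derivative_mem_differentIdeal (𝓞 L) L E x hadj
  have hminpoly : minpoly L (x : E) = (minpoly (𝓞 L) x).map (algebraMap (𝓞 L) L) :=
    minpoly.isIntegrallyClosed_eq_field_fractions L E (Algebra.IsIntegral.isIntegral x)
  set δ : 𝓞 E := Polynomial.aeval x (Polynomial.derivative (minpoly (𝓞 L) x)) with hδ
  have hψδ : ψ δ = Polynomial.eval (φ x)
      (Polynomial.derivative ((minpoly L (x : E)).map (algebraMap L K))) := by
    rw [hminpoly, Polynomial.map_map, Polynomial.derivative_map, Polynomial.eval_map, hδ,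
      Polynomial.aeval_def, Polynomial.hom_eval₂]
    have hcomp : ψ.comp (algebraMap (𝓞 L) (𝓞 E)) =
        (algebraMap L K).comp (algebraMap (𝓞 L) L) :=
      RingHom.ext fun a => φ.commutes (a : L)
    rw [hcomp]
    rfl
  set f := (minpoly L (x : E)).map (algebraMap L K) with hf
  have hfs : f.Splits := IsAlgClosed.splits _
  have hfm : f.Monic := (minpoly.monic hintx).map _
  have hroot : φ x ∈ f.roots := by
    rw [Polynomial.mem_roots hfm.ne_zero, Polynomial.IsRoot, hf, Polynomial.eval_map]
    rw [← Polynomial.aeval_def, Polynomial.aeval_algHom_apply, minpoly.aeval, map_zero]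
  rw [hfs.eval_root_derivative hfm hroot] at hψδ
  have hprod : ∀ s : Multiset K, s ≤ f.roots.erase (φ x) →
      ∃ c ∈ V, (M : K) ^ s.card = c * (s.map (φ x - ·)).prod := by
    intro s
    induction s using Multiset.induction_on with
    | empty => exact fun _ => ⟨1, one_mem _, by simp⟩
    | cons r s ih =>
      intro hs
      obtain ⟨c, hc, hcs⟩ := ih ((Multiset.le_cons_self s r).trans hs)
      have hsep : f.Separable := (minpoly.irreducible hintx).separable.map
      have hr : r ∈ f.roots.erase (φ x) := Multiset.mem_of_le hs (Multiset.mem_cons_self r s)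
      have hrne : r ≠ φ x := ((Polynomial.nodup_roots hsep).mem_erase_iff.mp hr).1
      have hr' : r ∈ (minpoly L (x : E)).rootSet K := by
        rw [Polynomial.rootSet, Finset.mem_coe, Multiset.mem_toFinset]
        exact Multiset.mem_of_mem_erase hr
      rw [← Algebra.IsAlgebraic.range_eval_eq_rootSet_minpoly_of_splits K
        (fun x => IsAlgClosed.splits _)] at hr'
      obtain ⟨σ, rfl⟩ := hr'
      obtain ⟨c', hc', hcM'⟩ := hxM σ (fun h => hrne (by rw [h]))
      refine ⟨c' * c, mul_mem hc' hc, ?_⟩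
      rw [Multiset.card_cons, pow_succ', hcs, hcM', Multiset.map_cons, Multiset.prod_cons]
      ring
  obtain ⟨a, ha, haM⟩ := hprod _ le_rfl
  rw [← hψδ] at haM
  have hcard : (f.roots.erase (φ x)).card ≤ Module.finrank L E := by
    calc (f.roots.erase (φ x)).card ≤ f.roots.card := Multiset.card_le_card (Multiset.erase_le _ _)
      _ ≤ f.natDegree := f.card_roots'
      _ = (minpoly L (x : E)).natDegree := Polynomial.natDegree_map _
      _ ≤ Module.finrank L E := minpoly.natDegree_le _
  have hδ0 : ψ δ ≠ 0 := by
    intro h0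
    rw [h0, mul_zero] at haM
    exact pow_ne_zero _ hMK haM
  obtain ⟨q, r, hq, hqV, hr⟩ := exists_mul_eq_of_mem_valuationSubring (φ : E →+* K) V
    ((M : E) ^ Module.finrank L E / δ) (by
      obtain ⟨j, hj⟩ := Nat.exists_eq_add_of_le hcard
      have hφδ : φ (δ : E) = ψ δ := rfl
      have : (φ : E →+* K) ((M : E) ^ Module.finrank L E / δ) = (M : K) ^ j * a := by
        rw [RingHom.coe_coe, map_div₀, map_pow, map_intCast, hφδ, div_eq_iff hδ0, mul_assoc, ← haM,
          ← pow_add, add_comm, hj]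
      rw [this]
      exact mul_mem (pow_mem (by simp) _) ha)
  refine hunit q ?_ hq hqV
  rw [hmem]
  have : q * (M : 𝓞 E) ^ Module.finrank L E = r * δ := by
    have hδE : (δ : E) ≠ 0 := fun h => hδ0 (by
      change φ (δ : E) = 0
      rw [h, map_zero])
    have h3 : (r : E) * δ = q * (M : E) ^ Module.finrank L E := by
      rw [hr]
      field_simp
    apply RingOfIntegers.coe_injective
    rw [map_mul, map_mul, map_pow, map_intCast]
    exact h3.symm
  rw [this]
  exact Ideal.mul_mem_left _ _ hdiff

/-- Finiteness of the set of extensions of bounded degree satisfying the hypothesis of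
`NumberField.intCast_pow_mem_differentIdeal` with a fixed `M`. -/
theorem NumberField.finite_setOf_intermediateField {L K : Type*} [Field L] [NumberField L]
    [Field K] [Algebra L K] [IsAlgClosed K] {M : ℤ} (hM : M ≠ 0) (d : ℕ) :
    {E : IntermediateField L K | FiniteDimensional L E ∧ Module.finrank L E ≤ d ∧
      ∀ V : ValuationSubring K, ∃ θ : E, (∀ σ : E →ₐ[L] K, σ θ ∈ V) ∧
        ∀ σ : E →ₐ[L] K, σ ≠ E.val → ∃ c ∈ V, (M : K) = c * (E.val θ - σ θ)}.Finite := by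
  have hchar : CharZero K := charZero_of_injective_algebraMap (algebraMap L K).injective
  have htower : IsScalarTower ℚ L K := .of_algebraMap_eq fun x => by simp
  let N : ℕ := (M.natAbs ^ d) ^ (d * Module.finrank ℚ L) * (discr L).natAbs ^ d
  have hfin := (NumberField.finite_of_discr_bdd K N).image Subtype.val
  refine (hfin.preimage (IntermediateField.restrictScalars_injective ℚ).injOn).subset ?_
  rintro E ⟨hE, hd, h⟩
  have hEnf : NumberField E :=
    { to_charZero := SubsemiringClass.instCharZero E
      to_finiteDimensional := by
        have : IsScalarTower ℚ L E := .of_algebraMap_eq fun x => by simp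
        exact Module.Finite.trans (R := ℚ) L E }
  have hmem := intCast_pow_mem_differentIdeal E.val hM h
  have hdiscr := natAbs_discr_eq_absNorm_differentIdeal_mul_natAbs_discr_pow L (𝓞 L) E (𝓞 E)
  have hn : Ideal.absNorm (differentIdeal (𝓞 L) (𝓞 E)) ≤
      (M.natAbs ^ d) ^ (d * Module.finrank ℚ L) := by
    have hle : Ideal.span {(M : 𝓞 E) ^ Module.finrank L E} ≤ differentIdeal (𝓞 L) (𝓞 E) :=
      (Ideal.span_singleton_le_iff_mem _).mpr hmem
    have hval : Ideal.absNorm (Ideal.span {(M : 𝓞 E) ^ Module.finrank L E}) =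
        (M.natAbs ^ Module.finrank L E) ^ Module.finrank ℚ E := by
      have : (M : 𝓞 E) ^ Module.finrank L E = algebraMap ℤ (𝓞 E) (M ^ Module.finrank L E) := by
        simp
      rw [Ideal.absNorm_span_singleton, this, Algebra.norm_algebraMap_of_basis
        (RingOfIntegers.basis E), ← Module.finrank_eq_card_chooseBasisIndex, RingOfIntegers.rank,
        Int.natAbs_pow, Int.natAbs_pow]
    have hpos : 0 < M.natAbs := Int.natAbs_pos.mpr hM
    have hrank : Module.finrank ℚ E = Module.finrank ℚ L * Module.finrank L E :=
      (Module.finrank_mul_finrank ℚ L E).symm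
    refine (Nat.le_of_dvd (by rw [hval]; positivity)
      (Ideal.absNorm_dvd_absNorm_of_le hle)).trans ?_
    rw [hval, hrank, mul_comm (Module.finrank ℚ L)]
    have h1 : Module.finrank L E * Module.finrank ℚ L ≤ d * Module.finrank ℚ L :=
      Nat.mul_le_mul_right _ hd
    exact (Nat.pow_le_pow_left (Nat.pow_le_pow_right hpos hd) _).trans
      (Nat.pow_le_pow_right (by positivity) h1)
  have hN : |discr E| ≤ N := by
    rw [Int.abs_eq_natAbs, hdiscr]
    norm_cast
    refine Nat.mul_le_mul hn ?_
    exact Nat.pow_le_pow_right (Int.natAbs_pos.mpr (discr_ne_zero L)) hd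
  have hfd : FiniteDimensional ℚ (E.restrictScalars ℚ) := hEnf.to_finiteDimensional
  exact ⟨⟨E.restrictScalars ℚ, hfd⟩, hN, rfl⟩

end RamificationBound

theorem ChartMap.evalVec_comp {k A B : Type} [CommRing k] [CommRing A] [Algebra k A] [CommRing B]
    [Algebra k B] {m n : ℕ} (Φ : ChartMap k m n) (g : A →ₐ[k] B) (c : Fin Φ.numCharts)
    (y : Fin (m + 1) → A) : Φ.evalVec c (g ∘ y) = g ∘ Φ.evalVec c y := by
  funext i
  simp only [ChartMap.evalVec, eval_map, Function.comp_apply]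
  exact (comp_aeval_apply (f := y) g (Φ.F c i)).symm

theorem unitEquiv.map {A B : Type} [CommRing A] [CommRing B] {N : ℕ} {a b : Fin N → A}
    (h : unitEquiv a b) (g : A →+* B) : unitEquiv (g ∘ a) (g ∘ b) := by
  obtain ⟨u, rfl⟩ := h
  exact ⟨Units.map g u, by ext i; simp⟩

theorem unitEquiv.symm {A : Type} [CommRing A] {N : ℕ} {a b : Fin N → A}
    (h : unitEquiv a b) : unitEquiv b a := by
  obtain ⟨u, rfl⟩ := h
  exact ⟨u⁻¹, by ext i; simp⟩

theorem unitEquiv.trans {A : Type} [CommRing A] {N : ℕ} {a b c : Fin N → A}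
    (h : unitEquiv a b) (h' : unitEquiv b c) : unitEquiv a c := by
  obtain ⟨u, rfl⟩ := h
  obtain ⟨v, rfl⟩ := h'
  exact ⟨v * u, by ext i; simp [mul_assoc]⟩

theorem comp_mem_ringPoints {k A B : Type} [CommRing k] [CommRing A] [Algebra k A] [CommRing B]
    [Algebra k B] {n : ℕ} {S : Set (MvPolynomial (Fin (n + 1)) k)} {a : Fin (n + 1) → A}
    (h : a ∈ ringPoints k S A) (g : A →ₐ[k] B) : g ∘ a ∈ ringPoints k S B := by
  obtain ⟨⟨i, hi⟩, h⟩ := h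
  refine ⟨⟨i, hi.map g⟩, fun f hf => ?_⟩
  have := h f hf
  rw [eval_map] at this ⊢
  have h2 := (comp_aeval_apply (f := a) g f).symm
  rw [aeval_def, aeval_def, this, map_zero] at h2
  exact h2

theorem comp_mem_fiberOver {k A B : Type} [Field k] [CommRing A] [Algebra k A] [CommRing B]
    [Algebra k B] {m n : ℕ} {Φ : ChartMap k m n} {S : Set (MvPolynomial (Fin (m + 1)) k)}
    {a : Fin (m + 1) → A} {b : Fin (n + 1) → A} (h : a ∈ fiberOver k Φ S A b) (g : A →ₐ[k] B) :
    g ∘ a ∈ fiberOver k Φ S B (g ∘ b) := by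
  obtain ⟨h, c, ⟨i, hi⟩, hc⟩ := h
  refine ⟨comp_mem_ringPoints h g, c, ⟨i, ?_⟩, ?_⟩
  · rw [Φ.evalVec_comp]
    exact hi.map g
  · rw [Φ.evalVec_comp]
    exact hc.map (g : A →+* B)

theorem MvPolynomial.aeval_add_sub_sub_mem {σ R A : Type*} [Fintype σ] [CommRing R] [CommRing A]
    [Algebra R A] (y h : σ → A) (f : MvPolynomial σ R) :
    aeval (y + h) f - aeval y f - ∑ a, aeval y (pderiv a f) * h a ∈
      Ideal.span (Set.range h) ^ 2 := by
  classical
  induction f using MvPolynomial.induction_on with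
  | C r => simp
  | add p q hp hq =>
    convert add_mem hp hq using 1
    simp only [map_add, add_mul, Finset.sum_add_distrib]
    ring
  | mul_X p i hp =>
    have hi : h i ∈ Ideal.span (Set.range h) := Ideal.subset_span ⟨i, rfl⟩
    have hs : ∑ a, aeval y (pderiv a p) * h a ∈ Ideal.span (Set.range h) :=
      Ideal.sum_mem _ fun a _ => Ideal.mul_mem_left _ _ (Ideal.subset_span ⟨a, rfl⟩)
    have h2 : (∑ a, aeval y (pderiv a p) * h a) * h i ∈ Ideal.span (Set.range h) ^ 2 := by
      rw [pow_two]
      exact Ideal.mul_mem_mul hs hi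
    have h3 := Ideal.mul_mem_right (y i + h i) _ hp
    convert add_mem h3 h2 using 1
    have : ∑ a, aeval y (pderiv a (p * X i)) * h a =
        (∑ a, aeval y (pderiv a p) * h a) * y i + aeval y p * h i := by
      simp only [Derivation.leibniz, pderiv_X, smul_eq_mul, map_add, map_mul, aeval_X, add_mul,
        Finset.sum_add_distrib, Finset.sum_mul]
      rw [add_comm]
      congr 1
      · exact Finset.sum_congr rfl fun a _ => by ring
      · rw [Finset.sum_eq_single i]
        · simp
        · intro b _ hb
          simp [hb.symm]
        · simp
    rw [this]
    simp only [map_mul, aeval_X, Pi.add_apply]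
    ring

theorem unitEquiv_of_forall_mul_eq {A : Type} [CommRing A] {N : ℕ} {a b : Fin N → A}
    {i : Fin N} (ha : IsUnit (a i)) (hb : IsUnit (b i)) (h : ∀ j, a j * b i = a i * b j) :
    unitEquiv a b := by
  obtain ⟨u, hu⟩ := ha
  obtain ⟨v, hv⟩ := hb
  refine ⟨v * u⁻¹, funext fun j => ?_⟩
  have := h j
  rw [← hu, ← hv] at this
  rw [Units.val_mul, mul_comm (v : A), mul_assoc, mul_comm (v : A), this, ← mul_assoc,
    Units.inv_mul, one_mul]

instance DualNumber.instModuleFinite (K : Type*) [Field K] : Module.Finite K (DualNumber K) :=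
  inferInstanceAs (Module.Finite K (K × K))

theorem DualNumber.isAlgClosed_residueField (K : Type*) [Field K] [IsAlgClosed K] :
    IsAlgClosed (IsLocalRing.ResidueField (DualNumber K)) := by
  let g : DualNumber K →+* K := (TrivSqZeroExt.fstHom K K K : DualNumber K →ₐ[K] K)
  have hg : IsLocalHom g := ⟨fun a ha => (TrivSqZeroExt.isUnit_iff_isUnit_fst).mpr ha⟩
  let r := IsLocalRing.ResidueField.lift g
  have hr : Function.Bijective r := by
    refine ⟨r.injective, fun x => ⟨IsLocalRing.residue _ (TrivSqZeroExt.inl x), ?_⟩⟩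
    simp [r, g]
  exact IsAlgClosed.of_ringEquiv K _ (RingEquiv.ofBijective r hr).symm

/-- Fibres of an étale morphism have no nonzero tangent vectors: a tangent vector of the cone over
`Y` which is killed by the differential of the morphism is radial. -/
theorem exists_eq_smul_of_isFiniteEtaleOfDegree {k K : Type} [Field k] [Field K] [IsAlgClosed K]
    [Algebra k K] {m n d : ℕ} {SY : Set (MvPolynomial (Fin (m + 1)) k)}
    {SX : Set (MvPolynomial (Fin (n + 1)) k)} {Φ : ChartMap k m n}
    (hmor : IsChartMorphism k Φ SY SX) (hetale : IsFiniteEtaleOfDegree k Φ SY SX d)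
    {y z : Fin (m + 1) → K} (hy : y ∈ ringPoints k SY K)
    (hz : ∀ f ∈ SY, ∑ a, aeval y (pderiv a f) * z a = 0)
    (hz' : ∀ c i j, (∑ a, aeval y (pderiv a (Φ.F c i)) * z a) * aeval y (Φ.F c j) =
      (∑ a, aeval y (pderiv a (Φ.F c j)) * z a) * aeval y (Φ.F c i)) :
    ∃ r : K, z = r • y := by
  let ι : K →ₐ[k] DualNumber K := TrivSqZeroExt.inlAlgHom k K K
  let π : DualNumber K →ₐ[k] K := TrivSqZeroExt.fstHom k K K
  have hπι : ∀ {N : ℕ} (a : Fin N → K), π ∘ ι ∘ a = a := fun a => by ext; simp [π, ι]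
  let w : Fin (m + 1) → DualNumber K := fun a => TrivSqZeroExt.inl (y a) + TrivSqZeroExt.inr (z a)
  have hπw : π ∘ w = y := by ext; simp [π, w]
  have hw : ∀ f : MvPolynomial (Fin (m + 1)) k, aeval w f = TrivSqZeroExt.inl (aeval y f) +
      TrivSqZeroExt.inr (∑ a, aeval y (pderiv a f) * z a) := by
    intro f
    have h1 := MvPolynomial.aeval_add_sub_sub_mem (ι ∘ y)
      (fun a => (TrivSqZeroExt.inr (z a) : DualNumber K)) f
    have h2 : Ideal.span (Set.range fun a => (TrivSqZeroExt.inr (z a) : DualNumber K)) ^ 2 = ⊥ := by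
      rw [pow_two, Ideal.span_mul_span', eq_bot_iff, Ideal.span_le]
      rintro _ ⟨_, ⟨a, rfl⟩, _, ⟨b, rfl⟩, rfl⟩
      simp
    rw [h2, Ideal.mem_bot, sub_sub, sub_eq_zero] at h1
    have h3 : ∀ g : MvPolynomial (Fin (m + 1)) k, aeval (ι ∘ y) g = TrivSqZeroExt.inl (aeval y g) :=
      fun g => (comp_aeval_apply (f := y) ι g).symm
    refine h1.trans ?_
    rw [h3]
    congr 1
    simp only [h3, TrivSqZeroExt.inl_mul_inr, smul_eq_mul, ← TrivSqZeroExt.inr_sum]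
  have hev : ∀ c i, Φ.evalVec c w i = aeval w (Φ.F c i) := fun c i => by
    rw [ChartMap.evalVec, eval_map]; rfl
  have hev' : ∀ c i, Φ.evalVec c y i = aeval y (Φ.F c i) := fun c i => by
    rw [ChartMap.evalVec, eval_map]; rfl
  have hunit : ∀ x : DualNumber K, IsUnit x ↔ IsUnit (π x) := fun x =>
    TrivSqZeroExt.isUnit_iff_isUnit_fst
  obtain ⟨c, hc⟩ := hmor.total K y hy
  have hb : Φ.evalVec c y ∈ ringPoints k SX K := hmor.mapsInto K y hy c hc
  have hKres : IsAlgClosed (IsLocalRing.ResidueField K) := by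
    have : Function.Bijective (IsLocalRing.residue K) :=
      ⟨(IsLocalRing.residue K).injective, IsLocalRing.residue_surjective⟩
    exact IsAlgClosed.of_ringEquiv K _ (RingEquiv.ofBijective _ this)
  have hart : IsArtinianRing (DualNumber K) := IsArtinianRing.of_finite K _
  obtain ⟨r, hr, hrinj, -⟩ := hetale K hKres _ hb
  obtain ⟨r', hr', -, hr'surj⟩ := hetale (DualNumber K) (DualNumber.isAlgClosed_residueField K)
    (ι ∘ Φ.evalVec c y) (comp_mem_ringPoints hb ι)
  choose p hp using fun j => hr'surj _ (comp_mem_fiberOver (hr j) ι)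
  have hpinj : Function.Injective p := by
    intro i j hij
    apply hrinj
    have h1 := hp i
    rw [hij] at h1
    have := (h1.trans (hp j).symm).map (π : DualNumber K →+* K)
    simpa [hπι] using this
  have hwmem : w ∈ fiberOver k Φ SY (DualNumber K) (ι ∘ Φ.evalVec c y) := by
    obtain ⟨⟨i, hi⟩, hyS⟩ := hy
    refine ⟨⟨⟨i, (hunit _).mpr ?_⟩, fun f hf => ?_⟩, c, ?_⟩
    · rw [← hπw] at hi
      exact hi
    · have h0 : aeval y f = 0 := by
        have := hyS f hf
        rwa [eval_map] at this
      have : aeval w f = 0 := by rw [hw, h0, hz f hf]; simp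
      rw [eval_map]
      exact this
    · obtain ⟨i, hi⟩ := hc
      have hi' : IsUnit (Φ.evalVec c w i) := by
        rw [hunit]
        change IsUnit ((π ∘ Φ.evalVec c w) i)
        rw [← Φ.evalVec_comp, hπw]
        exact hi
      refine ⟨⟨i, hi'⟩, unitEquiv_of_forall_mul_eq hi' (hi.map ι) fun j => ?_⟩
      change _ * ι _ = _ * ι _
      rw [hev, hev, hev', hev', hw, hw]
      ext
      · simp [ι, mul_comm]
      · have := hz' c j i
        simp only [ι]
        simpa using this
  obtain ⟨j', hj'⟩ := hr'surj _ hwmem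
  obtain ⟨j, rfl⟩ := (Finite.injective_iff_surjective.mp hpinj) j'
  obtain ⟨u, hu⟩ := hj'.trans (hp j).symm
  have hu0 : (u : DualNumber K).fst ≠ 0 := by
    have := (hunit _).mp u.isUnit
    exact this.ne_zero
  refine ⟨-((u : DualNumber K).snd / (u : DualNumber K).fst), funext fun a => ?_⟩
  have h1 := congrArg TrivSqZeroExt.snd (congrFun hu a)
  simp [ι, w] at h1
  rw [Pi.smul_apply, smul_eq_mul]
  field_simp
  linear_combination -h1

/-- The weak Nullstellensatz. -/
theorem MvPolynomial.exists_forall_eval_eq_zero_of_ne_top {σ K : Type*} [Field K] [IsAlgClosed K]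
    [Finite σ] {I : Ideal (MvPolynomial σ K)} (hI : I ≠ ⊤) :
    ∃ p : σ → K, ∀ f ∈ I, eval p f = 0 := by
  obtain ⟨J, hJ, hIJ⟩ := I.exists_le_maximal hI
  obtain ⟨p, rfl⟩ := isMaximal_iff_eq_vanishingIdeal_singleton.mp hJ
  refine ⟨p, fun f hf => ?_⟩
  simpa using hIJ hf

/-- If the rows `v i` span the whole space, then no nonzero vector is orthogonal to all of them. -/
theorem span_eq_top_of_forall_sum_eq_zero {K s ι : Type*} [Field K] [Fintype s]
    (v : ι → s → K) (h : ∀ z : s → K, (∀ i, ∑ a, v i a * z a = 0) → z = 0) :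
    Submodule.span K (Set.range v) = ⊤ := by
  classical
  by_contra hne
  obtain ⟨f, hf, hle⟩ := Submodule.exists_le_ker_of_lt_top _ (lt_top_iff_ne_top.mpr hne)
  have hfv : ∀ x : s → K, f x = ∑ a, x a * f (Pi.single a 1) := fun x => by
    conv_lhs => rw [← LinearMap.sum_single_apply (fun _ => K) x]
    rw [map_sum]
    refine Finset.sum_congr rfl fun a _ => ?_
    rw [show Pi.single a (x a) = x a • (Pi.single a 1 : s → K) by simp [← Pi.single_smul],
      map_smul, smul_eq_mul]
  have h0 := h (fun a => f (Pi.single a 1)) fun i => by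
    rw [← hfv]
    exact hle (Submodule.subset_span ⟨i, rfl⟩)
  apply hf
  ext x
  simpa using congrFun h0 x

theorem Ideal.mul_sub_mul_mem_of_sub_sub_mem {R : Type*} [CommRing R] (I : Ideal R) {a b a' b' s t
    : R}
    (h : a' * b - b' * a ∈ I) (hs : a' - a - s ∈ I) (ht : b' - b - t ∈ I) :
    s * b - t * a ∈ I := by
  have := sub_mem h (sub_mem (I.mul_mem_right b hs) (I.mul_mem_right a ht))
  convert this using 1
  ring

theorem sum_mul_sub_mul_mul {ι R : Type*} [Fintype ι] [CommRing R] (u v h : ι → R) (a b : R) :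
    ∑ i, (u i * b - v i * a) * h i = (∑ i, u i * h i) * b - (∑ i, v i * h i) * a := by
  simp only [Finset.sum_mul, ← Finset.sum_sub_distrib]
  exact Finset.sum_congr rfl fun i _ => by ring

section Separation

variable {k K : Type} [Field k] [Field K] [Algebra k K] {m n : ℕ}

/-- Equations of the fibre product `Y ×_X Y`, in the affine chart in which the linear form
`∑ a, t ^ a * Y a` equals `1` on both factors. -/
def fiberProductEqns (K : Type) [Field K] [Algebra k K] (Φ : ChartMap k m n)
    (SY : Set (MvPolynomial (Fin (m + 1)) k)) (t : ℕ) :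
    Set (MvPolynomial (Fin (m + 1) ⊕ Fin (m + 1)) K) :=
  {q | (∃ f ∈ SY, q = aeval (fun a => X (Sum.inl a)) f ∨ q = aeval (fun a => X (Sum.inr a)) f) ∨
    (∃ c i j, q = aeval (fun a => X (Sum.inr a)) (Φ.F c i) * aeval (fun a => X (Sum.inl a)) (Φ.F c
        j)
      - aeval (fun a => X (Sum.inr a)) (Φ.F c j) * aeval (fun a => X (Sum.inl a)) (Φ.F c i)) ∨
    q = (∑ a : Fin (m + 1), C ((t : K) ^ (a : ℕ)) * X (Sum.inl a)) - 1 ∨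
    q = (∑ a : Fin (m + 1), C ((t : K) ^ (a : ℕ)) * X (Sum.inr a)) - 1}

/-- The map of an étale morphism is unramified: the ideal of the diagonal is, modulo the equations
of the fibre product, idempotent. -/
theorem sub_mem_sq_sup_span_fiberProductEqns [IsAlgClosed K] {d : ℕ}
    {SY : Set (MvPolynomial (Fin (m + 1)) k)}
    {SX : Set (MvPolynomial (Fin (n + 1)) k)} {Φ : ChartMap k m n}
    (hmor : IsChartMorphism k Φ SY SX) (hetale : IsFiniteEtaleOfDegree k Φ SY SX d) (t : ℕ)
    (a : Fin (m + 1)) :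
    (X (Sum.inr a) - X (Sum.inl a) : MvPolynomial (Fin (m + 1) ⊕ Fin (m + 1)) K) ∈
      Ideal.span (Set.range fun a : Fin (m + 1) =>
        (X (Sum.inr a) - X (Sum.inl a) : MvPolynomial (Fin (m + 1) ⊕ Fin (m + 1)) K)) ^ 2 ⊔
      Ideal.span (fiberProductEqns K Φ SY t) := by
  classical
  set y : Fin (m + 1) → MvPolynomial (Fin (m + 1) ⊕ Fin (m + 1)) K := fun a => X (Sum.inl a) with hy
  set y' : Fin (m + 1) → MvPolynomial (Fin (m + 1) ⊕ Fin (m + 1)) K :=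
    fun a => X (Sum.inr a) with hy'
  set δ : Fin (m + 1) → MvPolynomial (Fin (m + 1) ⊕ Fin (m + 1)) K :=
    fun a => X (Sum.inr a) - X (Sum.inl a) with hδ
  set J := Ideal.span (fiberProductEqns K Φ SY t) with hJ
  set I := Ideal.span (Set.range δ) ^ 2 ⊔ J with hI
  have hyδ : y + δ = y' := by ext1 a; simp [hy, hy', hδ]
  have htaylor : ∀ f : MvPolynomial (Fin (m + 1)) k,
      aeval y' f - aeval y f - ∑ a, aeval y (pderiv a f) * δ a ∈ I := fun f =>
    Ideal.mem_sup_left (hyδ ▸ MvPolynomial.aeval_add_sub_sub_mem y δ f)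
  have hJI : ∀ q ∈ fiberProductEqns K Φ SY t, q ∈ I := fun q hq =>
    Ideal.mem_sup_right (Ideal.subset_span hq)
  have hδ2 : ∀ a b, δ a * δ b ∈ I := fun a b => Ideal.mem_sup_left (by
    rw [pow_two]
    exact Ideal.mul_mem_mul (Ideal.subset_span ⟨a, rfl⟩) (Ideal.subset_span ⟨b, rfl⟩))
  let W : Submodule (MvPolynomial (Fin (m + 1) ⊕ Fin (m + 1)) K)
      (Fin (m + 1) → MvPolynomial (Fin (m + 1) ⊕ Fin (m + 1)) K) :=
    { carrier := {v | ∑ a, v a * δ a ∈ I}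
      add_mem' := fun {v w} (hv : ∑ a, v a * δ a ∈ I) (hw : ∑ a, w a * δ a ∈ I) => by
        have := add_mem hv hw
        simpa [add_mul, Finset.sum_add_distrib] using this
      zero_mem' := by simp
      smul_mem' := fun r v (hv : ∑ a, v a * δ a ∈ I) => by
        have := Ideal.mul_mem_left _ r hv
        simpa [Finset.mul_sum, mul_assoc] using this }
  have hW : ∀ v, v ∈ W ↔ ∑ a, v a * δ a ∈ I := fun v => Iff.rfl
  let Q : Ideal (MvPolynomial (Fin (m + 1) ⊕ Fin (m + 1)) K) :=
    { carrier := {s | ∀ a, s * δ a ∈ I}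
      add_mem' := fun {v w} hv hw a => by
        rw [add_mul]
        exact add_mem (hv a) (hw a)
      zero_mem' := fun a => by simp
      smul_mem' := fun r v hv a => by
        rw [smul_eq_mul, mul_assoc]
        exact Ideal.mul_mem_left _ r (hv a) }
  have hQ : ∀ s, s ∈ Q ↔ ∀ a, s * δ a ∈ I := fun s => Iff.rfl
  suffices h : Q = ⊤ by
    have h1 : (1 : MvPolynomial (Fin (m + 1) ⊕ Fin (m + 1)) K) ∈ Q := h ▸ Submodule.mem_top
    simpa using (hQ 1).mp h1 a
  by_contra hne
  obtain ⟨p, hp⟩ := MvPolynomial.exists_forall_eval_eq_zero_of_ne_top hne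
  have hpJ : ∀ q ∈ fiberProductEqns K Φ SY t, eval p q = 0 := fun q hq =>
    hp q ((hQ q).mpr fun a => Ideal.mul_mem_right _ _ (hJI q hq))
  have hpδ : ∀ a, p (Sum.inr a) = p (Sum.inl a) := fun a => by
    have := hp (δ a) ((hQ _).mpr fun b => hδ2 a b)
    simpa [hδ, sub_eq_zero] using this
  set x : Fin (m + 1) → K := fun a => p (Sum.inl a) with hx
  have hpy : ∀ f : MvPolynomial (Fin (m + 1)) k, eval p (aeval y f) = aeval x f := fun f => by
    have := comp_aeval_apply (f := y) ((aeval p).restrictScalars k : _ →ₐ[k] K) f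
    simpa [hy] using this
  have hpy' : ∀ f : MvPolynomial (Fin (m + 1)) k, eval p (aeval y' f) = aeval x f := fun f => by
    have := comp_aeval_apply (f := y') ((aeval p).restrictScalars k : _ →ₐ[k] K) f
    simpa [hy', hpδ] using this
  have hxl : ∑ a : Fin (m + 1), (t : K) ^ (a : ℕ) * x a = 1 := by
    have := hpJ _ (Or.inr (Or.inr (Or.inl rfl)))
    simpa [sub_eq_zero] using this
  have hxS : x ∈ ringPoints k SY K := by
    refine ⟨?_, fun f hf => ?_⟩
    · by_contra! hcon
      simp only [isUnit_iff_ne_zero, not_not] at hcon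
      simp [hcon] at hxl
    · rw [eval_map, ← aeval_def, ← hpy]
      exact hpJ _ (Or.inl ⟨f, hf, Or.inl rfl⟩)
  obtain ⟨g, hg, hgW⟩ := exists_smul_mem_span_of_span_eq_top (eval p) (fun v : W => v.1) (by
    refine span_eq_top_of_forall_sum_eq_zero _ fun z hz => ?_
    have hz1 : ∀ v ∈ W, ∑ a, eval p (v a) * z a = 0 := fun v hv => hz ⟨v, hv⟩
    obtain ⟨r, hr⟩ := exists_eq_smul_of_isFiniteEtaleOfDegree hmor hetale (z := z) hxS
      (fun f hf => by
        have h1 := hz1 (fun a => aeval y (pderiv a f)) (by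
          rw [hW]
          have := sub_mem (sub_mem (hJI _ (Or.inl ⟨f, hf, Or.inr rfl⟩))
            (hJI _ (Or.inl ⟨f, hf, Or.inl rfl⟩))) (htaylor f)
          rwa [sub_sub_cancel] at this)
        simpa [hpy] using h1)
      (fun c i j => by
        have h1 := hz1 (fun a => aeval y (pderiv a (Φ.F c i)) * aeval y (Φ.F c j) -
            aeval y (pderiv a (Φ.F c j)) * aeval y (Φ.F c i)) (by
          have hG : aeval y' (Φ.F c i) * aeval y (Φ.F c j) -
              aeval y' (Φ.F c j) * aeval y (Φ.F c i) ∈ I :=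
            hJI _ (Or.inr (Or.inl ⟨c, i, j, rfl⟩))
          rw [hW, sum_mul_sub_mul_mul]
          exact I.mul_sub_mul_mem_of_sub_sub_mem hG (htaylor _) (htaylor _))
        rw [← sub_eq_zero, ← h1]
        simp only [map_sub, map_mul, hpy]
        rw [sum_mul_sub_mul_mul])
    have h1 := hz1 (fun a => C ((t : K) ^ (a : ℕ))) (by
      rw [hW]
      have := sub_mem (hJI _ (Or.inr (Or.inr (Or.inr rfl)))) (hJI _ (Or.inr (Or.inr (Or.inl rfl))))
      simpa [hδ, mul_sub, Finset.sum_sub_distrib] using this)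
    simp only [eval_C] at h1
    have hr0 : r = 0 := by
      have : r * ∑ a : Fin (m + 1), (t : K) ^ (a : ℕ) * x a = 0 := by
        rw [Finset.mul_sum, ← h1, hr]
        exact Finset.sum_congr rfl fun a _ => by rw [Pi.smul_apply, smul_eq_mul]; ring
      rwa [hxl, mul_one] at this
    rw [hr, hr0, zero_smul])
  refine hg (hp g ((hQ g).mpr fun b => ?_))
  have h1 : g • Pi.single b 1 ∈ W := by
    have h2 := hgW (Pi.single b 1)
    have hrange : Set.range (fun v : W => v.1) = W := Subtype.range_coe
    rwa [hrange, Submodule.span_eq] at h2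
  rw [hW] at h1
  simpa [Pi.single_apply] using h1

end Separation

section FibreSeparation

variable {k K : Type} [Field k] [Field K] [Algebra k K] {m n : ℕ}
  {SY : Set (MvPolynomial (Fin (m + 1)) k)} {SX : Set (MvPolynomial (Fin (n + 1)) k)}
  {Φ : ChartMap k m n}

theorem unitEquiv.mul_eq_mul {A : Type} [CommRing A] {N : ℕ} {a b : Fin N → A}
    (h : unitEquiv a b) (i j : Fin N) : b i * a j = b j * a i := by
  obtain ⟨u, rfl⟩ := h
  ring

theorem IsChartMorphism.mul_eq_mul_of_mem_fiberOver (hmor : IsChartMorphism k Φ SY SX)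
    {y y' : Fin (m + 1) → K} {b : Fin (n + 1) → K} (hy : y ∈ fiberOver k Φ SY K b)
    (hy' : y' ∈ fiberOver k Φ SY K b) (c : Fin Φ.numCharts) (i j : Fin (n + 1)) :
    Φ.evalVec c y' i * Φ.evalVec c y j = Φ.evalVec c y' j * Φ.evalVec c y i := by
  by_cases h : ∃ i, IsUnit (Φ.evalVec c y i)
  · by_cases h' : ∃ i, IsUnit (Φ.evalVec c y' i)
    · obtain ⟨hy, c₁, h₁, hb⟩ := hy
      obtain ⟨hy', c₂, h₂, hb'⟩ := hy'
      exact (((hmor.compat K y hy c c₁ h h₁).trans hb).trans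
        ((hmor.compat K y' hy' c c₂ h' h₂).trans hb').symm).mul_eq_mul i j
    · simp only [isUnit_iff_ne_zero, not_exists, not_not] at h'
      rw [h', h', zero_mul, zero_mul]
  · simp only [isUnit_iff_ne_zero, not_exists, not_not] at h
    rw [h, h, mul_zero, mul_zero]

theorem ValuationSubring.exists_forall_eq_mul {ι : Type*} [Finite ι] [Nonempty ι]
    (V : ValuationSubring K) (x : ι → K) : ∃ a, ∀ b, ∃ c ∈ V, x b = c * x a := by
  obtain ⟨a, ha⟩ := Finite.exists_max fun a => V.valuation (x a)
  refine ⟨a, fun b => ?_⟩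
  by_cases h0 : x a = 0
  · have := ha b
    rw [h0, map_zero, le_zero_iff, map_eq_zero] at this
    exact ⟨0, zero_mem _, by rw [this, zero_mul]⟩
  · refine ⟨x b / x a, ?_, by field_simp⟩
    rw [← V.valuation_le_one_iff, map_div₀]
    exact div_le_one_of_le₀ (ha b) zero_le

/-- Distinct points of a fibre of an étale morphism stay apart, uniformly and with respect to
every valuation, up to a fixed integer. -/
theorem exists_int_forall_exists_eq_mul_sub [IsAlgClosed K] [CharZero K]
    [Algebra.IsAlgebraic ℚ K] {d : ℕ} (hmor : IsChartMorphism k Φ SY SX)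
    (hetale : IsFiniteEtaleOfDegree k Φ SY SX d) (t : ℕ) {N : ℤ} (hN : N ≠ 0) :
    ∃ M : ℤ, M ≠ 0 ∧ ∀ (V : ValuationSubring K) (b : Fin (n + 1) → K) (y y' : Fin (m + 1) → K),
      y ∈ fiberOver k Φ SY K b → y' ∈ fiberOver k Φ SY K b →
      ∑ a : Fin (m + 1), (t : K) ^ (a : ℕ) * y a = 1 →
      ∑ a : Fin (m + 1), (t : K) ^ (a : ℕ) * y' a = 1 →
      (∀ a, (N : K) * y a ∈ V) → (∀ a, (N : K) * y' a ∈ V) → y ≠ y' →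
      ∃ a, ∃ c ∈ V, (M : K) = c * (y' a - y a) := by
  classical
  have hδ : ∀ a : Fin (m + 1), ∃ h : Fin (m + 1) → Fin (m + 1) →
      MvPolynomial (Fin (m + 1) ⊕ Fin (m + 1)) K,
      (X (Sum.inr a) - X (Sum.inl a)) - ∑ c, (∑ b, h c b * (X (Sum.inr b) - X (Sum.inl b))) *
        (X (Sum.inr c) - X (Sum.inl c)) ∈ Ideal.span (fiberProductEqns K Φ SY t) := by
    intro a
    obtain ⟨s, hs, j, hj, hsj⟩ := Submodule.mem_sup.mp
      (sub_mem_sq_sup_span_fiberProductEqns (K := K) hmor hetale t a)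
    rw [pow_two, ← smul_eq_mul, Submodule.mem_ideal_smul_span_iff_exists_sum] at hs
    obtain ⟨u, hu, hus⟩ := hs
    choose h hh using fun c => (Ideal.mem_span_range_iff_exists_fun).mp (hu c)
    refine ⟨h, ?_⟩
    rw [Finsupp.sum_fintype _ _ (by simp)] at hus
    simp only [hh]
    rw [← hsj, ← hus]
    simpa [smul_eq_mul] using hj
  choose h hh using hδ
  choose M hM hMV using fun x : Fin (m + 1) × Fin (m + 1) × Fin (m + 1) =>
    MvPolynomial.exists_int_mul_eval_mem hN (h x.1 x.2.1 x.2.2)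
  refine ⟨∏ x, M x, Finset.prod_ne_zero_iff.mpr fun x _ => hM x, ?_⟩
  intro V b y y' hy hy' hly hly' hyV hy'V hne
  set P := ∏ x, M x with hP
  let p : Fin (m + 1) ⊕ Fin (m + 1) → K := Sum.elim y y'
  have hPV : ∀ a b c, (P : K) * eval p (h a b c) ∈ V := by
    intro a b c
    obtain ⟨r, hr⟩ := Finset.dvd_prod_of_mem M (Finset.mem_univ (a, b, c))
    have := mul_mem (intCast_mem V r)
      (hMV (a, b, c) V p (Sum.forall.mpr ⟨hyV, hy'V⟩))
    convert this using 1
    rw [hP, hr]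
    push_cast
    ring
  have hp0 : ∀ q ∈ Ideal.span (fiberProductEqns K Φ SY t), eval p q = 0 := by
    intro q hq
    rw [← RingHom.mem_ker]
    revert q
    change Ideal.span _ ≤ _
    rw [Ideal.span_le]
    have hpl : ∀ f : MvPolynomial (Fin (m + 1)) k,
        eval p (aeval (fun a => X (Sum.inl a)) f) = aeval y f := fun f => by
      have := comp_aeval_apply (f := fun a => (X (Sum.inl a) : MvPolynomial _ K))
        ((aeval p).restrictScalars k : MvPolynomial (Fin (m + 1) ⊕ Fin (m + 1)) K →ₐ[k] K) f
      simpa [p] using this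
    have hpr : ∀ f : MvPolynomial (Fin (m + 1)) k,
        eval p (aeval (fun a => X (Sum.inr a)) f) = aeval y' f := fun f => by
      have := comp_aeval_apply (f := fun a => (X (Sum.inr a) : MvPolynomial _ K))
        ((aeval p).restrictScalars k : MvPolynomial (Fin (m + 1) ⊕ Fin (m + 1)) K →ₐ[k] K) f
      simpa [p] using this
    rintro q (⟨f, hf, rfl | rfl⟩ | ⟨c, i, j, rfl⟩ | rfl | rfl)
    · have := hy.1.2 f hf
      rw [eval_map] at this
      exact (hpl f).trans this
    · have := hy'.1.2 f hf
      rw [eval_map] at this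
      exact (hpr f).trans this
    · have := hmor.mul_eq_mul_of_mem_fiberOver hy hy' c i j
      simp only [ChartMap.evalVec, eval_map, ← aeval_def] at this
      simp [RingHom.mem_ker, hpl, hpr, this]
    · simp [RingHom.mem_ker, p, hly]
    · simp [RingHom.mem_ker, p, hly']
  obtain ⟨a, ha⟩ := V.exists_forall_eq_mul fun a => y' a - y a
  choose e heV he using ha
  have hda : y' a - y a ≠ 0 := by
    intro h0
    apply hne
    funext b
    have := he b
    rw [h0, mul_zero, sub_eq_zero] at this
    exact this.symm
  have hkey := hp0 _ (hh a)
  simp only [map_sub, map_sum, map_mul, eval_X, p, Sum.elim_inl, Sum.elim_inr] at hkey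
  refine ⟨a, ∑ c, (∑ b, (P : K) * eval p (h a c b) * e b) * e c, ?_, ?_⟩
  · exact sum_mem fun c _ => mul_mem (sum_mem fun b _ => mul_mem (hPV _ _ _) (heV b)) (heV c)
  · have h1 : (∑ c, (∑ b, eval p (h a c b) * e b) * e c) * (y' a - y a) = 1 := by
      apply mul_right_cancel₀ hda
      rw [one_mul]
      refine Eq.trans ?_ (sub_eq_zero.mp hkey).symm
      simp only [Finset.sum_mul]
      refine Finset.sum_congr rfl fun c _ => Finset.sum_congr rfl fun b _ => ?_
      rw [he b, he c]
      ring
    refine (mul_one _).symm.trans ?_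
    rw [← h1, ← mul_assoc]
    congr 1
    simp only [Finset.mul_sum, Finset.sum_mul, mul_assoc]

end FibreSeparation

theorem MvPolynomial.IsHomogeneous.aeval_mul {σ R A : Type*} [CommSemiring R] [CommSemiring A]
    [Algebra R A] {f : MvPolynomial σ R} {e : ℕ} (hf : f.IsHomogeneous e) (u : A) (x : σ → A) :
    MvPolynomial.aeval (fun i => u * x i) f = u ^ e * MvPolynomial.aeval x f := by
  rw [aeval_def, aeval_def, eval₂_eq, eval₂_eq, Finset.mul_sum]
  refine Finset.sum_congr rfl fun d hd => ?_
  have : ∏ i ∈ d.support, u ^ d i = u ^ e := by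
    rw [Finset.prod_pow_eq_pow_sum, ← hf (mem_support_iff.mp hd), Finsupp.weight_apply]
    simp [Finsupp.sum]
  simp only [mul_pow, Finset.prod_mul_distrib, this]
  ring

section FiberOver

variable {k A : Type} [Field k] [CommRing A] [Algebra k A] {m n : ℕ}
  {SY : Set (MvPolynomial (Fin (m + 1)) k)} {Φ : ChartMap k m n}

theorem mul_mem_ringPoints (hS : ∀ f ∈ SY, ∃ e, f.IsHomogeneous e) {y : Fin (m + 1) → A}
    (hy : y ∈ ringPoints k SY A) (u : Aˣ) : (fun i => (u : A) * y i) ∈ ringPoints k SY A := by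
  obtain ⟨⟨i, hi⟩, h⟩ := hy
  refine ⟨⟨i, u.isUnit.mul hi⟩, fun f hf => ?_⟩
  obtain ⟨e, he⟩ := hS f hf
  have := h f hf
  rw [eval_map, ← aeval_def] at this ⊢
  rw [he.aeval_mul, this, mul_zero]

theorem ChartMap.evalVec_mul (Φ : ChartMap k m n) (c : Fin Φ.numCharts) (u : A)
    (y : Fin (m + 1) → A) :
    Φ.evalVec c (fun i => u * y i) = fun i => u ^ Φ.deg c * Φ.evalVec c y i := by
  funext i
  simp only [ChartMap.evalVec, eval_map, ← aeval_def]
  exact (Φ.homog c i).aeval_mul u y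

theorem mul_mem_fiberOver (hS : ∀ f ∈ SY, ∃ e, f.IsHomogeneous e) {y : Fin (m + 1) → A}
    {b : Fin (n + 1) → A} (hy : y ∈ fiberOver k Φ SY A b) (u : Aˣ) :
    (fun i => (u : A) * y i) ∈ fiberOver k Φ SY A b := by
  obtain ⟨hy, c, ⟨i, hi⟩, hc⟩ := hy
  refine ⟨mul_mem_ringPoints hS hy u, c, ⟨i, ?_⟩, ?_⟩
  · rw [Φ.evalVec_mul]
    exact (u.isUnit.pow _).mul hi
  · rw [Φ.evalVec_mul]
    have : unitEquiv (Φ.evalVec c y) fun i => (u : A) ^ Φ.deg c * Φ.evalVec c y i :=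
      ⟨u ^ Φ.deg c, by simp⟩
    exact this.symm.trans hc

theorem mem_fiberOver_of_comp_mem {E K : Type} [Field E] [Field K] [Algebra k E] [Algebra k K]
    (g : E →ₐ[k] K) {y : Fin (m + 1) → E} {b : Fin (n + 1) → E}
    (h : g ∘ y ∈ fiberOver k Φ SY K (g ∘ b)) : y ∈ fiberOver k Φ SY E b := by
  obtain ⟨⟨⟨i, hi⟩, h⟩, c, ⟨j, hj⟩, u, hu⟩ := h
  rw [isUnit_iff_ne_zero] at hi hj
  have hj' : Φ.evalVec c y j ≠ 0 := by
    rintro h0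
    rw [Φ.evalVec_comp, Function.comp_apply, h0, map_zero] at hj
    exact hj rfl
  refine ⟨⟨⟨i, ?_⟩, fun f hf => ?_⟩, c, ⟨j, hj'.isUnit⟩, ?_⟩
  · rw [isUnit_iff_ne_zero]
    rintro h0
    rw [Function.comp_apply, h0, map_zero] at hi
    exact hi rfl
  · have := h f hf
    rw [eval_map, ← aeval_def] at this
    rw [eval_map, ← aeval_def]
    exact (map_eq_zero g).mp ((comp_aeval_apply (f := y) g f).trans this)
  · rw [Φ.evalVec_comp] at hu
    have hb : ∀ i, g (b i) = u * g (Φ.evalVec c y i) := fun i => congrFun hu i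
    refine unitEquiv_of_forall_mul_eq (i := j) hj'.isUnit (isUnit_iff_ne_zero.mpr fun h0 => ?_) fun
        l => ?_
    · have := hb j
      rw [h0, map_zero] at this
      rcases mul_eq_zero.mp this.symm with h | h
      · exact u.ne_zero h
      · exact hj' ((map_eq_zero g).mp h)
    · apply g.injective
      change g (_ * _) = g (_ * _)
      rw [map_mul, map_mul, hb, hb]
      ring

end FiberOver

section ChevalleyWeil

variable {k L K : Type} [Field k] [Field L] [Field K] [Algebra k L] [Algebra L K]
  [Algebra k K] [IsScalarTower k L K]
  {m n : ℕ} {SY : Set (MvPolynomial (Fin (m + 1)) k)} {SX : Set (MvPolynomial (Fin (n + 1)) k)}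
  {Φ : ChartMap k m n} {d : ℕ}

theorem algHom_comp_mem_fiberOver {E : IntermediateField L K} {x : Fin (n + 1) → L}
    {z : Fin (m + 1) → E} (hz : E.val ∘ z ∈ fiberOver k Φ SY K (algebraMap L K ∘ x))
    (σ : E →ₐ[L] K) : σ ∘ z ∈ fiberOver k Φ SY K (algebraMap L K ∘ x) := by
  have h : ∀ τ : E →ₐ[L] K, τ ∘ (algebraMap L E ∘ x) = algebraMap L K ∘ x := fun τ =>
    funext fun i => τ.commutes (x i)
  have hz' : z ∈ fiberOver k Φ SY E (algebraMap L E ∘ x) := by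
    refine mem_fiberOver_of_comp_mem (E.val.restrictScalars k) ?_
    change E.val ∘ z ∈ fiberOver k Φ SY K (E.val ∘ (algebraMap L E ∘ x))
    rwa [h]
  have := comp_mem_fiberOver hz' (σ.restrictScalars k)
  change σ ∘ z ∈ fiberOver k Φ SY K (σ ∘ (algebraMap L E ∘ x)) at this
  rwa [h] at this

variable [NumberField L] [IsAlgClosed K]

theorem finrank_le_of_isFiniteEtaleOfDegree (hetale : IsFiniteEtaleOfDegree k Φ SY SX d)
    {x : Fin (n + 1) → L} (hx : x ∈ ringPoints k SX L) {E : IntermediateField L K}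
    [FiniteDimensional L E] {z : Fin (m + 1) → E}
    (hz : E.val ∘ z ∈ fiberOver k Φ SY K (algebraMap L K ∘ x)) {i : Fin (m + 1)} (hi : z i = 1)
    (hgen : ∀ σ τ : E →ₐ[L] K, (∀ a, σ (z a) = τ (z a)) → σ = τ) :
    Module.finrank L E ≤ d := by
  have hacl : IsAlgClosed (IsLocalRing.ResidueField K) :=
    IsAlgClosed.of_ringEquiv K _ (RingEquiv.ofBijective _
      ⟨(IsLocalRing.residue K).injective, IsLocalRing.residue_surjective⟩)
  have hxK : algebraMap L K ∘ x ∈ ringPoints k SX K :=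
    comp_mem_ringPoints hx (IsScalarTower.toAlgHom k L K)
  obtain ⟨r, -, -, hr⟩ := hetale K hacl _ hxK
  choose j hj using fun σ : E →ₐ[L] K => hr _ (algHom_comp_mem_fiberOver hz σ)
  have hinj : Function.Injective j := by
    intro σ τ hστ
    obtain ⟨u, hu⟩ := (hj σ).trans (hστ ▸ (hj τ).symm)
    have hu1 := congrFun hu i
    simp only [Function.comp_apply, hi, map_one, mul_one] at hu1
    refine hgen σ τ fun a => ?_
    have := congrFun hu a
    simp only [← hu1, one_mul] at this
    exact this.symm
  rw [← AlgHom.card L E K]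
  simpa using Fintype.card_le_of_injective j hinj

variable [CharZero K] [Algebra.IsAlgebraic ℚ K]

variable (K) in
theorem exists_int_forall_exists_intermediateField (hS : ∀ f ∈ SY, ∃ e, f.IsHomogeneous e)
    (hmor : IsChartMorphism k Φ SY SX) (hd : 0 < d)
    (hetale : IsFiniteEtaleOfDegree k Φ SY SX d) :
    ∃ M : ℤ, M ≠ 0 ∧ ∀ x ∈ ringPoints k SX L, ∃ E : IntermediateField L K,
      (FiniteDimensional L E ∧ Module.finrank L E ≤ d ∧ ∀ V : ValuationSubring K,
        ∃ θ : E, (∀ σ : E →ₐ[L] K, σ θ ∈ V) ∧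
          ∀ σ : E →ₐ[L] K, σ ≠ E.val → ∃ c ∈ V, (M : K) = c * (E.val θ - σ θ)) ∧
      ∃ z : Fin (m + 1) → E, E.val ∘ z ∈ fiberOver k Φ SY K (algebraMap L K ∘ x) := by
  classical
  obtain ⟨P, hP0, hP⟩ := exists_int_forall_exists_moment_form_bound m d
  choose M hM0 hM using fun t : ℕ =>
    exists_int_forall_exists_eq_mul_sub (K := K) hmor hetale t hP0
  refine ⟨(∏ t ∈ Finset.range (m * d + 1), M t) * P ^ 2,
    mul_ne_zero (Finset.prod_ne_zero_iff.mpr fun t _ => hM0 t) (pow_ne_zero 2 hP0), ?_⟩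
  intro x hx
  have hacl : IsAlgClosed (IsLocalRing.ResidueField K) :=
    IsAlgClosed.of_ringEquiv K _ (RingEquiv.ofBijective _
      ⟨(IsLocalRing.residue K).injective, IsLocalRing.residue_surjective⟩)
  obtain ⟨r, hr, -, -⟩ := hetale K hacl _
    (comp_mem_ringPoints hx (IsScalarTower.toAlgHom k L K))
  obtain ⟨i, hi⟩ := (hr ⟨0, hd⟩).1.1
  obtain ⟨y, hy, hyi⟩ : ∃ y ∈ fiberOver k Φ SY K (algebraMap L K ∘ x), y i = 1 :=
    ⟨_, mul_mem_fiberOver hS (hr ⟨0, hd⟩) hi.unit⁻¹, hi.val_inv_mul⟩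
  set E := IntermediateField.adjoin L (Set.range y) with hE
  have : Algebra.IsAlgebraic L K := Algebra.IsAlgebraic.tower_top (K := ℚ) L
  have hfin : FiniteDimensional L E :=
    IntermediateField.finiteDimensional_adjoin fun a _ => Algebra.IsIntegral.isIntegral a
  let z : Fin (m + 1) → E := fun a => ⟨y a, IntermediateField.subset_adjoin _ _ ⟨a, rfl⟩⟩
  have hz : E.val ∘ z ∈ fiberOver k Φ SY K (algebraMap L K ∘ x) := hy
  have hzi : z i = 1 := Subtype.ext hyi
  have hgen : ∀ σ τ : E →ₐ[L] K, (∀ a, σ (z a) = τ (z a)) → σ = τ := fun σ τ h =>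
    IntermediateField.adjoin_algHom_ext L (by rintro _ ⟨a, rfl⟩; exact h a)
  have hrank := finrank_le_of_isFiniteEtaleOfDegree hetale hx hz hzi hgen
  refine ⟨E, ⟨hfin, hrank, fun V => ?_⟩, z, hz⟩
  have hcard : Fintype.card (E →ₐ[L] K) ≤ d := (AlgHom.card L E K).trans_le hrank
  obtain ⟨t, ht, htP⟩ := hP K V (E →ₐ[L] K) hcard fun σ a => σ (z a)
  set ℓ : E := ∑ b : Fin (m + 1), (t : E) ^ (b : ℕ) * z b with hℓ
  have hℓσ : ∀ σ : E →ₐ[L] K, ∑ b : Fin (m + 1), (t : K) ^ (b : ℕ) * σ (z b) = σ ℓ := by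
    intro σ
    simp [hℓ]
  simp only [hℓσ] at htP
  have hℓ0 : ℓ ≠ 0 := by
    intro h0
    obtain ⟨c, -, hc⟩ := htP E.val i
    rw [h0, map_zero, mul_zero, hzi, map_one, mul_one] at hc
    exact hP0 (by exact_mod_cast hc)
  have hℓσ0 : ∀ σ : E →ₐ[L] K, σ ℓ ≠ 0 := fun σ => (map_ne_zero σ).mpr hℓ0
  let w : Fin (m + 1) → E := fun a => ℓ⁻¹ * z a
  have hw : E.val ∘ w ∈ fiberOver k Φ SY K (algebraMap L K ∘ x) := by
    have := mul_mem_fiberOver hS hz (Units.mk0 _ (hℓσ0 E.val))⁻¹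
    convert this using 1
    funext a
    simp [w]
  have hwV : ∀ (σ : E →ₐ[L] K) a, (P : K) * σ (w a) ∈ V := by
    intro σ a
    obtain ⟨c, hcV, hc⟩ := htP σ a
    convert hcV using 1
    rw [map_mul, map_inv₀, mul_left_comm, hc, mul_comm c, inv_mul_cancel_left₀ (hℓσ0 σ)]
  have hw1 : ∀ σ : E →ₐ[L] K, ∑ a : Fin (m + 1), (t : K) ^ (a : ℕ) * σ (w a) = 1 := by
    intro σ
    simp only [w, map_mul, map_inv₀, mul_left_comm _ (σ ℓ)⁻¹, ← Finset.mul_sum, hℓσ]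
    exact inv_mul_cancel₀ (hℓσ0 σ)
  have hsep : ∀ σ : E →ₐ[L] K, σ ≠ E.val →
      ∃ a, ∃ c ∈ V, (M t : K) = c * (σ (w a) - E.val (w a)) := by
    intro σ hσ
    refine hM t V _ (E.val ∘ w) (σ ∘ w) hw (algHom_comp_mem_fiberOver hw σ) (hw1 _) (hw1 _)
      (hwV _) (hwV _) fun h => hσ (hgen _ _ fun a => ?_)
    have h' : ∀ a, E.val (w a) = σ (w a) := congrFun h
    have hi' := h' i
    simp only [w, hzi, mul_one, map_inv₀, inv_inj] at hi'
    have ha := h' a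
    simp only [w, map_mul, map_inv₀, hi'] at ha
    exact (mul_left_cancel₀ (inv_ne_zero (hℓσ0 σ)) ha).symm
  obtain ⟨s, -, hs⟩ := hP K V {σ : E →ₐ[L] K // σ ≠ E.val}
    ((Fintype.card_subtype_le _).trans hcard) fun σ a => E.val (w a) - σ.1 (w a)
  have hsum : ∀ σ : E →ₐ[L] K, σ ((P : E) * ∑ b : Fin (m + 1), (s : E) ^ (b : ℕ) * w b) =
      P * ∑ b : Fin (m + 1), (s : K) ^ (b : ℕ) * σ (w b) := by
    intro σ
    simp
  refine ⟨(P : E) * ∑ b : Fin (m + 1), (s : E) ^ (b : ℕ) * w b, fun σ => ?_, fun σ hσ => ?_⟩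
  · rw [hsum, Finset.mul_sum]
    refine sum_mem fun b _ => ?_
    rw [mul_left_comm]
    exact mul_mem (pow_mem (natCast_mem V s) _) (hwV σ b)
  · obtain ⟨a, c, hcV, hc⟩ := hsep σ hσ
    obtain ⟨c', hcV', hc'⟩ := hs ⟨σ, hσ⟩ a
    obtain ⟨q, hq⟩ := Finset.dvd_prod_of_mem M ht
    refine ⟨q * -c * c', mul_mem (mul_mem (intCast_mem V q) (neg_mem hcV)) hcV', ?_⟩
    simp only [mul_sub, Finset.sum_sub_distrib] at hc'
    rw [hsum, hsum, hq]
    push_cast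
    rw [hc]
    linear_combination (-q * c * P) * hc'

variable (K) in
/-- The Chevalley–Weil theorem. -/
theorem exists_finiteDimensional_forall_exists_mem_fiberOver
    (hS : ∀ f ∈ SY, ∃ e, f.IsHomogeneous e) (hmor : IsChartMorphism k Φ SY SX) (hd : 0 < d)
    (hetale : IsFiniteEtaleOfDegree k Φ SY SX d) :
    ∃ L' : IntermediateField L K, FiniteDimensional L L' ∧ ∀ x ∈ ringPoints k SX L,
      ∃ y : Fin (m + 1) → L', y ∈ fiberOver k Φ SY L' (algebraMap L L' ∘ x) := by
  obtain ⟨M, hM, h⟩ := exists_int_forall_exists_intermediateField (L := L) K hS hmor hd hetale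
  have hfin := NumberField.finite_setOf_intermediateField (L := L) (K := K) hM d
  refine ⟨⨆ E ∈ hfin.toFinset, E, IntermediateField.finiteDimensional_iSup_of_finset'
    fun E hE => ((Set.Finite.mem_toFinset _).mp hE).1, fun x hx => ?_⟩
  obtain ⟨E, hE, z, hz⟩ := h x hx
  have hle : E ≤ ⨆ E ∈ hfin.toFinset, E :=
    le_iSup₂_of_le E ((Set.Finite.mem_toFinset _).mpr hE) le_rfl
  refine ⟨IntermediateField.inclusion hle ∘ z, ?_⟩
  refine mem_fiberOver_of_comp_mem (((⨆ E ∈ hfin.toFinset, E).val).restrictScalars k) ?_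
  exact hz

end ChevalleyWeil

namespace MvPolynomial

section Elimination

variable {σ R K : Type*} [CommRing R]

theorem IsHomogeneous.homogeneousComponent_mul {ℓ : MvPolynomial σ R} {e : ℕ}
    (hℓ : ℓ.IsHomogeneous e) (N : ℕ) (h : MvPolynomial σ R) :
    homogeneousComponent (N + e) (ℓ * h) = ℓ * homogeneousComponent N h := by
  conv_lhs => rw [← sum_homogeneousComponent h, Finset.mul_sum, map_sum]
  have h1 : ∀ i, homogeneousComponent (N + e) (ℓ * homogeneousComponent i h) =
      if N = i then ℓ * homogeneousComponent i h else 0 := fun i => by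
    rw [homogeneousComponent_of_mem
      (hℓ.mul (homogeneousComponent_isHomogeneous i h) : _ ∈ homogeneousSubmodule σ R (e + i))]
    simp only [add_comm N e, Nat.add_left_cancel_iff]
  simp only [h1, Finset.sum_ite_eq, Finset.mem_range]
  split_ifs with hN
  · rfl
  · rw [homogeneousComponent_eq_zero N h (by omega), mul_zero]

theorem homogeneousComponent_mem_span {G : Set (MvPolynomial σ R)}
    (hG : ∀ P ∈ G, ∃ e, P.IsHomogeneous e) {p : MvPolynomial σ R} (hp : p ∈ Ideal.span G)
    (N : ℕ) : homogeneousComponent N p ∈ Ideal.span G := by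
  let _ := MvPolynomial.gradedAlgebra (σ := σ) (R := R)
  exact (mem_iff_homogeneousComponent_mem
    (Ideal.homogeneous_span (homogeneousSubmodule σ R) G hG) p).mp hp N

theorem coeff_mem_span_of_mem_map [Field K] {s : Type*} (φ : R →+* K) (e : s → σ →₀ ℕ)
    (J : Ideal (MvPolynomial σ R)) {q : MvPolynomial σ K} (hq : q ∈ J.map (map φ)) :
    (fun d => coeff (e d) q) ∈
      Submodule.span K (Set.range fun (P : J) (d : s) => φ (coeff (e d) P.1)) := by
  suffices h : ∀ a, (fun d => coeff (e d) (a * q)) ∈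
      Submodule.span K (Set.range fun (P : J) (d : s) => φ (coeff (e d) P.1)) by
    simpa using h 1
  refine Submodule.span_induction (p := fun q _ => ∀ a, (fun d => coeff (e d) (a * q)) ∈
      Submodule.span K (Set.range fun (P : J) (d : s) => φ (coeff (e d) P.1))) ?_ ?_ ?_ ?_ hq
  · rintro _ ⟨P, hP, rfl⟩ a
    induction a using MvPolynomial.induction_on' with
    | monomial u c =>
      have : (fun d => coeff (e d) (monomial u c * map φ P)) =
          c • fun d => φ (coeff (e d) (monomial u 1 * P)) := by
        funext d
        rw [show monomial u c = C c * map φ (monomial u (1 : R)) by simp [C_mul_monomial],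
          mul_assoc, coeff_C_mul, ← map_mul, coeff_map]
        rfl
      rw [this]
      exact Submodule.smul_mem _ _
        (Submodule.subset_span ⟨⟨_, J.mul_mem_left (monomial u 1) hP⟩, rfl⟩)
    | add a b ha hb =>
      simp only [add_mul, coeff_add]
      exact add_mem ha hb
  · intro a
    simp only [mul_zero, coeff_zero]
    exact zero_mem _
  · intro x y _ _ hx hy a
    simp only [mul_add, coeff_add]
    exact add_mem (hx a) (hy a)
  · intro b x _ hx a
    simpa [mul_assoc] using hx (a * b)

/-- The projective Nullstellensatz. -/
theorem exists_pow_span_X_le [Field K] [IsAlgClosed K] [Finite σ] {I : Ideal (MvPolynomial σ K)}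
    (hI : ∀ y : σ → K, (∀ f ∈ I, eval y f = 0) → y = 0) :
    ∃ N, Ideal.span (Set.range X) ^ N ≤ I := by
  refine Ideal.exists_pow_le_of_le_radical_of_fg_radical ?_ (IsNoetherian.noetherian _)
  rw [Ideal.span_le, ← vanishingIdeal_zeroLocus_eq_radical (K := K)]
  rintro _ ⟨i, rfl⟩
  rw [SetLike.mem_coe, mem_vanishingIdeal_iff]
  intro y hy
  rw [hI y fun f hf => by simpa [coe_aeval_eq_eval] using hy f hf]
  simp

theorem monomial_mem_span_X_pow [Field K] [Fintype σ] (d : σ →₀ ℕ) (c : K) :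
    monomial d c ∈ Ideal.span (Set.range (X : σ → MvPolynomial σ K)) ^ d.degree := by
  rw [monomial_eq]
  refine Ideal.mul_mem_left _ _ ?_
  rw [Finsupp.degree_apply, ← Finset.prod_pow_eq_pow_sum, Finsupp.prod]
  exact Ideal.prod_mem_prod fun i _ => Ideal.pow_mem_pow (Ideal.subset_span (Set.mem_range_self i))
      _

/-- Elimination theory: if a linear form has no zero on the projective scheme cut out by `G` over
one geometric point of the base, then, after inverting a function on the base, the powers of the
coordinates are divisible by the linear form modulo `G`. -/
theorem exists_C_mul_X_pow_sub_mem_span [Field K] [IsAlgClosed K] [Fintype σ] (φ : R →+* K)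
    {G : Set (MvPolynomial σ R)} (hG : ∀ P ∈ G, ∃ e, P.IsHomogeneous e) {ℓ : MvPolynomial σ R}
    (hℓ : ℓ.IsHomogeneous 1)
    (hz : ∀ y : σ → K, (∀ P ∈ G, eval y (map φ P) = 0) → eval y (map φ ℓ) = 0 → y = 0) :
    ∃ N g, φ g ≠ 0 ∧ ∀ k, ∃ Q : MvPolynomial σ R, Q.IsHomogeneous N ∧
      C g * X k ^ (N + 1) - ℓ * Q ∈ Ideal.span G := by
  classical
  set J : Ideal (MvPolynomial σ R) := Ideal.span G ⊔ Ideal.span {ℓ} with hJ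
  have hGJ : Ideal.span G ≤ J := le_sup_left
  have hℓJ : ℓ ∈ J := (le_sup_right : _ ≤ J) (Ideal.mem_span_singleton_self ℓ)
  obtain ⟨N, hN⟩ := exists_pow_span_X_le (I := J.map (map φ)) fun y hy => hz y
    (fun P hP => hy _ (Ideal.mem_map_of_mem _ (hGJ (Ideal.subset_span hP))))
    (hy _ (Ideal.mem_map_of_mem _ hℓJ))
  let s := (Finset.univ : Finset σ).finsuppAntidiag (N + 1)
  have hs : ∀ d, d ∈ s ↔ d.degree = N + 1 := fun d => by
    simp [s, Finset.mem_finsuppAntidiag, Finsupp.degree_eq_sum]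
  have htop : Submodule.span K
      (Set.range fun (P : J) (d : s) => φ (coeff d.1 P.1)) = ⊤ := by
    rw [eq_top_iff]
    rintro w -
    have hmem : ∑ d : s, monomial d.1 (w d) ∈ J.map (map φ) :=
      sum_mem fun d _ => hN (Ideal.pow_le_pow_right (by rw [(hs _).mp d.2]; omega)
        (monomial_mem_span_X_pow d.1 (w d)))
    convert coeff_mem_span_of_mem_map φ (fun d : s => d.1) J hmem using 1
    funext d
    simp [coeff_sum, coeff_monomial, Subtype.ext_iff.symm]
  obtain ⟨g, hg, hgw⟩ := exists_smul_mem_span_of_span_eq_top φ (fun (P : J) (d : s) => coeff d.1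
      P.1) htop
  refine ⟨N, g, hg, fun k => ?_⟩
  have hk : Finsupp.single k (N + 1) ∈ s := by simp [hs]
  let lin : MvPolynomial σ R →ₗ[R] (s → R) := LinearMap.pi fun d => lcoeff R d.1
  have hle : Submodule.span R (Set.range fun (P : J) (d : s) => coeff d.1 P.1) ≤
      (J.restrictScalars R).map lin := by
    rw [Submodule.span_le]
    rintro _ ⟨P, rfl⟩
    exact ⟨P.1, P.2, rfl⟩
  obtain ⟨P, hP, hPw⟩ := hle (hgw (Pi.single ⟨_, hk⟩ 1))
  have hcomp : homogeneousComponent (N + 1) P = C g * X k ^ (N + 1) := by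
    ext d
    rw [coeff_homogeneousComponent, X_pow_eq_monomial, C_mul_monomial, mul_one, coeff_monomial]
    split_ifs with h1 h2 h2
    · have := congrFun hPw ⟨d, (hs d).mpr h1⟩
      subst h2
      simpa [lin] using this
    · have := congrFun hPw ⟨d, (hs d).mpr h1⟩
      rw [Pi.smul_apply, Pi.single_eq_of_ne fun h => h2 (Subtype.ext_iff.mp h).symm,
        smul_zero] at this
      exact this
    · subst h2
      simp at h1
    · rfl
  obtain ⟨A, hA, B, hB, rfl⟩ := Submodule.mem_sup.mp hP
  obtain ⟨h, rfl⟩ := Ideal.mem_span_singleton'.mp hB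
  refine ⟨homogeneousComponent N h, homogeneousComponent_isHomogeneous N h, ?_⟩
  rw [← hcomp, map_add, mul_comm h, hℓ.homogeneousComponent_mul, add_sub_cancel_right]
  exact homogeneousComponent_mem_span hG hA _

end Elimination

end MvPolynomial

section GraphElimination

variable {k F K : Type} [Field k] [Field F] [Field K] [Algebra k F] [Algebra F K] [Algebra k K]
  [IsScalarTower k F K] {m n : ℕ} {SY : Set (MvPolynomial (Fin (m + 1)) k)}
  {SX : Set (MvPolynomial (Fin (n + 1)) k)} {Φ : ChartMap k m n} {d : ℕ}

theorem IsChartMorphism.evalVec_mul_eq_mul (hmor : IsChartMorphism k Φ SY SX)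
    {y : Fin (m + 1) → F} {x : Fin (n + 1) → F} (hy : y ∈ fiberOver k Φ SY F x)
    (c : Fin Φ.numCharts) (i j : Fin (n + 1)) :
    Φ.evalVec c y i * x j = Φ.evalVec c y j * x i := by
  by_cases h : ∃ i, IsUnit (Φ.evalVec c y i)
  · obtain ⟨hy, c₁, h₁, hb⟩ := hy
    rw [mul_comm, mul_comm _ (x i)]
    exact ((hmor.compat F y hy c c₁ h h₁).trans hb).mul_eq_mul j i
  · simp only [isUnit_iff_ne_zero, not_exists, not_not] at h
    rw [h, h, zero_mul, zero_mul]

theorem IsChartMorphism.mem_fiberOver_of_mul_eq_mul (hmor : IsChartMorphism k Φ SY SX)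
    {y : Fin (m + 1) → F} {x : Fin (n + 1) → F} (hy : y ∈ ringPoints k SY F)
    (hx : ∃ i, x i ≠ 0) (h : ∀ c i j, Φ.evalVec c y i * x j = Φ.evalVec c y j * x i) :
    y ∈ fiberOver k Φ SY F x := by
  obtain ⟨c, i, hi⟩ := hmor.total F y hy
  obtain ⟨j, hj⟩ := hx
  refine ⟨hy, c, ⟨i, hi⟩, unitEquiv_of_forall_mul_eq (i := i) hi (isUnit_iff_ne_zero.mpr ?_)
    fun l => h c l i⟩
  intro h0
  have := h c i j
  rw [h0, mul_zero] at this
  exact mul_ne_zero hi.ne_zero hj this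

theorem exists_forall_sum_pow_mul_ne_zero [IsAlgClosed K] [CharZero K]
    (hetale : IsFiniteEtaleOfDegree k Φ SY SX d) {x : Fin (n + 1) → K}
    (hx : x ∈ ringPoints k SX K) :
    ∃ t : ℕ, ∀ y ∈ fiberOver k Φ SY K x, ∑ b : Fin (m + 1), (t : K) ^ (b : ℕ) * y b ≠ 0 := by
  have hacl : IsAlgClosed (IsLocalRing.ResidueField K) :=
    IsAlgClosed.of_ringEquiv K _ (RingEquiv.ofBijective _
      ⟨(IsLocalRing.residue K).injective, IsLocalRing.residue_surjective⟩)
  obtain ⟨r, hr, -, hry⟩ := hetale K hacl _ hx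
  obtain ⟨M, hM, h⟩ := exists_int_forall_exists_moment_form_bound m d
  obtain ⟨t, -, ht⟩ := h K ⊤ (Fin d) (by simp) r
  refine ⟨t, fun y hy h0 => ?_⟩
  obtain ⟨j, u, hu⟩ := hry y hy
  obtain ⟨i, hi⟩ := hy.1.1
  obtain ⟨c, -, hc⟩ := ht j i
  have : ∑ b : Fin (m + 1), (t : K) ^ (b : ℕ) * r j b = 0 := by
    simp only [hu, mul_left_comm _ (u : K), ← Finset.mul_sum, h0, mul_zero]
  rw [this, mul_zero, hu] at hc
  exact mul_ne_zero (Int.cast_ne_zero.mpr hM) (mul_ne_zero u.ne_zero hi.ne_zero) hc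

theorem exists_aeval_ne_zero_and_forall_mem_fiberOver [IsAlgClosed K] [CharZero K]
    (hS : ∀ f ∈ SY, ∃ e, f.IsHomogeneous e)
    (hmor : IsChartMorphism k Φ SY SX) (hetale : IsFiniteEtaleOfDegree k Φ SY SX d)
    {x₀ : Fin (n + 1) → K} (hx₀ : x₀ ∈ ringPoints k SX K) :
    ∃ (t N : ℕ) (g : MvPolynomial (Fin (n + 1)) F), aeval x₀ g ≠ 0 ∧
      ∀ a, ∃ Q : MvPolynomial (Fin (m + 1)) (MvPolynomial (Fin (n + 1)) F), Q.IsHomogeneous N ∧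
        ∀ (x : Fin (n + 1) → F) (y : Fin (m + 1) → F), y ∈ fiberOver k Φ SY F x →
          eval x g * y a ^ (N + 1) =
            (∑ b : Fin (m + 1), (t : F) ^ (b : ℕ) * y b) * eval y (map (eval x) Q) := by
  obtain ⟨t, ht⟩ := exists_forall_sum_pow_mul_ne_zero hetale hx₀
  let R := MvPolynomial (Fin (n + 1)) F
  let φ : R →+* K := (aeval x₀ : R →ₐ[F] K)
  let G : Set (MvPolynomial (Fin (m + 1)) R) := {P | (∃ e, P.IsHomogeneous e) ∧
    ∀ (x : Fin (n + 1) → F) (y : Fin (m + 1) → F), y ∈ fiberOver k Φ SY F x →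
      eval y (map (eval x) P) = 0}
  let ℓ : MvPolynomial (Fin (m + 1)) R := ∑ b : Fin (m + 1), C ((t : R) ^ (b : ℕ)) * X b
  have hℓ : ℓ.IsHomogeneous 1 := IsHomogeneous.sum _ _ _ fun b _ => by
    simpa using (isHomogeneous_C _ ((t : R) ^ (b : ℕ))).mul (isHomogeneous_X R b)
  have hcomp : ∀ x : Fin (n + 1) → F, (eval x).comp (algebraMap k R) = algebraMap k F := by
    intro x
    ext c
    exact eval_C _
  have hcompφ : φ.comp (algebraMap k R) = algebraMap k K := by
    ext c
    simp [R, φ]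
  obtain ⟨N, g, hg, hQ⟩ := exists_C_mul_X_pow_sub_mem_span φ (G := G) (fun P hP => hP.1) hℓ (by
    intro y hy hy0
    by_contra hne
    obtain ⟨a, ha⟩ := Function.ne_iff.mp hne
    have hyS : y ∈ ringPoints k SY K := by
      refine ⟨⟨a, isUnit_iff_ne_zero.mpr ha⟩, fun f hf => ?_⟩
      have := hy (map (algebraMap k R) f) ⟨?_, fun x z hz => ?_⟩
      · rwa [map_map, hcompφ] at this
      · obtain ⟨e, he⟩ := hS f hf
        exact ⟨e, he.map _⟩
      · rw [map_map, hcomp]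
        exact hz.1.2 f hf
    obtain ⟨i, hi⟩ := hx₀.1
    refine ht y (hmor.mem_fiberOver_of_mul_eq_mul hyS ⟨i, hi.ne_zero⟩ fun c i j => ?_) ?_
    · have := hy (map (algebraMap k R) (Φ.F c i) * C (X j) -
        map (algebraMap k R) (Φ.F c j) * C (X i)) ⟨⟨Φ.deg c, ?_⟩, fun x z hz => ?_⟩
      · simp only [map_sub, map_mul, map_map, hcompφ, map_C, eval_C] at this
        have hX : ∀ i, φ (X i) = x₀ i := aeval_X x₀
        simp only [hX] at this
        exact sub_eq_zero.mp this
      · refine IsHomogeneous.sub ?_ ?_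
        · simpa using ((Φ.homog c i).map (algebraMap k R)).mul (isHomogeneous_C _ (X j : R))
        · simpa using ((Φ.homog c j).map (algebraMap k R)).mul (isHomogeneous_C _ (X i : R))
      · simp only [map_sub, map_mul, map_map, hcomp, map_C, eval_C, eval_X]
        exact sub_eq_zero.mpr (hmor.evalVec_mul_eq_mul hz c i j)
    · simpa [ℓ, map_sum] using hy0)
  refine ⟨t, N, g, hg, fun a => ?_⟩
  obtain ⟨Q, hQN, hQ⟩ := hQ a
  refine ⟨Q, hQN, fun x y hy => ?_⟩
  have hle : Ideal.span G ≤ RingHom.ker ((eval y).comp (map (eval x))) :=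
    Ideal.span_le.mpr fun P hP => hP.2 x y hy
  have := hle hQ
  rw [RingHom.mem_ker, RingHom.comp_apply] at this
  simp only [map_sub, map_mul, map_C, eval_C, map_pow, map_X, eval_X, ℓ, map_sum,
    map_natCast] at this
  exact sub_eq_zero.mp this

end GraphElimination

theorem Finsupp.exists_forall_prod_pow_eq_prod {σ F : Type*} [CommMonoid F] {N : ℕ} (e : σ →₀ ℕ)
    (he : e.degree = N) : ∃ f : Fin N → σ, ∀ x : σ → F, (e.prod fun i c => x i ^ c) = ∏ j, x (f j)
        := by
  have hl : e.toMultiset.toList.length = N := by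
    rw [Multiset.length_toList, Finsupp.card_toMultiset]
    exact he
  subst hl
  refine ⟨fun j => e.toMultiset.toList.get j, fun x => ?_⟩
  have h : (e.prod fun i c => x i ^ c) = (e.toMultiset.map x).prod := by
    rw [Finsupp.toMultiset_map, Finsupp.prod_toMultiset, Finsupp.prod_mapDomain_index] <;>
      simp [pow_add]
  rw [h]
  conv_lhs => rw [← Multiset.coe_toList e.toMultiset]
  simp

theorem Finsupp.exists_forall_prod_pow_eq_prod_of_le {σ F : Type*} [CommMonoid F] {D : ℕ} (i : σ)
    (e : σ →₀ ℕ) (he : e.degree ≤ D) :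
    ∃ f : Fin D → σ, ∀ x : σ → F, x i = 1 → (e.prod fun i c => x i ^ c) = ∏ j, x (f j) := by
  obtain ⟨f, hf⟩ := Finsupp.exists_forall_prod_pow_eq_prod (F := F)
    (e + Finsupp.single i (D - e.degree)) (N := D) (by
      rw [map_add, Finsupp.degree_single]
      omega)
  refine ⟨f, fun x hx => ?_⟩
  classical
  rw [← hf, Finsupp.prod_add_index' (h := fun i c => x i ^ c) (by simp)
    (fun _ _ _ => pow_add _ _ _), Finsupp.prod_single_index (h := fun i c => x i ^ c) (pow_zero _),
        hx, one_pow, mul_one]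

theorem MvPolynomial.exists_forall_eval_map_eq_sum {σ τ F : Type*} [Field F] [Fintype σ]
    [Fintype τ] (i : σ) {N D : ℕ} {Q : MvPolynomial τ (MvPolynomial σ F)} (hQ : Q.IsHomogeneous N)
    (hD : ∀ d ∈ Q.support, (coeff d Q).totalDegree ≤ D) :
    ∃ A : (Fin D → σ) × (Fin N → τ) → F, ∀ (x : σ → F) (y : τ → F), x i = 1 →
      eval y (map (eval x) Q) = ∑ p, A p * ((∏ j, x (p.1 j)) * ∏ j, y (p.2 j)) := by
  let w : (Fin D → σ) × (Fin N → τ) → {x : σ → F // x i = 1} × (τ → F) → F :=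
    fun p z => (∏ j, z.1.1 (p.1 j)) * ∏ j, z.2 (p.2 j)
  have hmem : (fun z : {x : σ → F // x i = 1} × (τ → F) => eval z.2 (map (eval z.1.1) Q)) ∈
      Submodule.span F (Set.range w) := by
    have : (fun z : {x : σ → F // x i = 1} × (τ → F) => eval z.2 (map (eval z.1.1) Q)) =
        ∑ d ∈ Q.support, ∑ e ∈ (coeff d Q).support, coeff e (coeff d Q) •
          fun z => (e.prod fun i c => z.1.1 i ^ c) * (d.prod fun i c => z.2 i ^ c) := by
      funext z
      simp only [eval_map, eval₂_eq, Finset.sum_apply, Pi.smul_apply, smul_eq_mul]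
      refine Finset.sum_congr rfl fun d hd => ?_
      rw [eval_eq, Finset.sum_mul]
      refine Finset.sum_congr rfl fun e he => ?_
      rw [mul_assoc]
      rfl
    rw [this]
    refine sum_mem fun d hd => sum_mem fun e he => Submodule.smul_mem _ _ ?_
    obtain ⟨f, hf⟩ := Finsupp.exists_forall_prod_pow_eq_prod_of_le (F := F) i e
      ((le_totalDegree he).trans (hD d hd))
    obtain ⟨h, hh⟩ := Finsupp.exists_forall_prod_pow_eq_prod (F := F) d
      (N := N) (by
        have := hQ (mem_support_iff.mp hd)
        rw [← this, Finsupp.degree_eq_weight_one]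
        rfl)
    refine Submodule.subset_span ⟨(f, h), ?_⟩
    funext z
    simp only [w, hf _ z.1.2, hh]
  obtain ⟨A, hA⟩ := (Submodule.mem_span_range_iff_exists_fun F).mp hmem
  refine ⟨A, fun x y hx => ?_⟩
  have := congrFun hA (⟨x, hx⟩, y)
  simpa [w] using this.symm

theorem Height.exists_forall_mulHeight_le {σ τ F : Type*} [Field F] [Height.AdmissibleAbsValues F]
    [Fintype σ] [Fintype τ] [Nonempty τ] (i : σ) (N : ℕ) (ℓ : (τ → F) → F) (g : MvPolynomial σ F)
    (Q : τ → MvPolynomial τ (MvPolynomial σ F)) (hQ : ∀ a, (Q a).IsHomogeneous N) :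
    ∃ (B : ℝ) (D : ℕ), 1 ≤ B ∧ ∀ (x : σ → F) (y : τ → F), x i = 1 → eval x g ≠ 0 → y ≠ 0 →
      (∀ a, eval x g * y a ^ (N + 1) = ℓ y * eval y (map (eval x) (Q a))) →
      Height.mulHeight y ≤ B * Height.mulHeight x ^ D := by
  let D := Finset.univ.sup fun a => (Q a).support.sup fun d => (coeff d (Q a)).totalDegree
  have hD : ∀ a, ∀ d ∈ (Q a).support, (coeff d (Q a)).totalDegree ≤ D := fun a d hd =>
    (Finset.le_sup (f := fun d => (coeff d (Q a)).totalDegree) hd).trans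
      (Finset.le_sup (f := fun a => (Q a).support.sup fun d => (coeff d (Q a)).totalDegree)
        (Finset.mem_univ a))
  choose A hA using fun a => exists_forall_eval_map_eq_sum i (hQ a) (hD a)
  let A' : τ × ((Fin D → σ) × (Fin N → τ)) → F := fun p => A p.1 p.2
  have : Nonempty σ := ⟨i⟩
  let B := Nat.card ((Fin D → σ) × (Fin N → τ)) ^ Height.totalWeight F * Height.mulHeight A'
  have hB : 1 ≤ B := one_le_mul_of_one_le_of_one_le
    (by exact_mod_cast Nat.one_le_pow _ _ Nat.card_pos) (Height.one_le_mulHeight _)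
  refine ⟨B, D, hB, fun x y hx hg hy h => ?_⟩
  have hx0 : x ≠ 0 := fun h => by simp [h] at hx
  obtain ⟨a, ha⟩ := Function.ne_iff.mp hy
  have hℓ : ℓ y ≠ 0 := by
    intro h0
    have := h a
    rw [h0, zero_mul] at this
    exact mul_ne_zero hg (pow_ne_zero _ ha) this
  have h1 : Height.mulHeight (y ^ (N + 1)) =
      Height.mulHeight (fun a => ∑ p, A' (a, p) * ((∏ j, x (p.1 j)) * ∏ j, y (p.2 j))) := by
    rw [← Height.mulHeight_smul_eq_mulHeight (y ^ (N + 1)) hg,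
      ← Height.mulHeight_smul_eq_mulHeight (fun a => ∑ p, _) hℓ]
    congr 1
    funext a
    simp only [Pi.smul_apply, Pi.pow_apply, smul_eq_mul, h a, hA a x y hx, A']
  have h2 := Height.mulHeight_linearMap_apply_le A' (fun p => (∏ j, x (p.1 j)) * ∏ j, y (p.2 j))
  have hpx : (fun f : Fin D → σ => ∏ j, x (f j)) ≠ 0 :=
    Function.ne_iff.mpr ⟨fun _ => i, by simp [hx]⟩
  have hpy : (fun f : Fin N → τ => ∏ j, y (f j)) ≠ 0 :=
    Function.ne_iff.mpr ⟨fun _ => a, by simpa using fun h => absurd h ha⟩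
  have h3 := Height.mulHeight_fun_mul_eq hpx hpy
  have h4 := Height.mulHeight_fun_prod_eq (x := fun _ : Fin D => x) fun _ => hx0
  have h5 := Height.mulHeight_fun_prod_eq (x := fun _ : Fin N => y) fun _ => hy
  simp only [Finset.prod_const, Finset.card_univ, Fintype.card_fin] at h4 h5
  rw [← h1, Height.mulHeight_pow, h3, h4, h5, pow_succ'] at h2
  have hpos : 0 < Height.mulHeight y ^ N := pow_pos (Height.mulHeight_pos y) _
  rw [← mul_assoc] at h2
  exact le_of_mul_le_mul_right h2 hpos

section HeightBound

variable {k F : Type} [Field k] [Field F] [Algebra k F] {m n : ℕ}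
  {SY : Set (MvPolynomial (Fin (m + 1)) k)} {SX : Set (MvPolynomial (Fin (n + 1)) k)}
  {Φ : ChartMap k m n} {d : ℕ}

/-- The height of a point is bounded polynomially by the height of its image under a finite
morphism. -/
theorem exists_forall_fiberOver_mulHeight_le [Height.AdmissibleAbsValues F] (K : Type) [Field K]
    [Algebra F K] [Algebra k K] [IsScalarTower k F K] [IsAlgClosed K] [CharZero K]
    (hSY : ∀ f ∈ SY, ∃ e, f.IsHomogeneous e)
    (hSX : ∀ f ∈ SX, ∃ e, f.IsHomogeneous e) (hmor : IsChartMorphism k Φ SY SX)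
    (hetale : IsFiniteEtaleOfDegree k Φ SY SX d) :
    ∃ (B : ℝ) (D : ℕ), 1 ≤ B ∧ ∀ x ∈ ringPoints k SX F, ∀ y ∈ fiberOver k Φ SY F x,
      Height.mulHeight y ≤ B * Height.mulHeight x ^ D := by
  let Good : Set (MvPolynomial (Fin (n + 1)) F) := {g | ∀ i, ∃ (B : ℝ) (D : ℕ), 1 ≤ B ∧
    ∀ (x : Fin (n + 1) → F), x i = 1 → eval x g ≠ 0 → ∀ y ∈ fiberOver k Φ SY F x,
      Height.mulHeight y ≤ B * Height.mulHeight x ^ D}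
  have hgood : ∀ x ∈ ringPoints k SX F, ∃ g ∈ Good, eval x g ≠ 0 := by
    intro x hx
    obtain ⟨t, N, g, hg, hQ⟩ := exists_aeval_ne_zero_and_forall_mem_fiberOver (F := F) hSY hmor
        hetale
      (comp_mem_ringPoints hx (IsScalarTower.toAlgHom k F K))
    choose Q hQN hQ using hQ
    refine ⟨g, fun i => ?_, fun h0 => hg ?_⟩
    · obtain ⟨B, D, hB, h⟩ := Height.exists_forall_mulHeight_le i N
        (fun y : Fin (m + 1) → F => ∑ b : Fin (m + 1), (t : F) ^ (b : ℕ) * y b) g Q hQN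
      refine ⟨B, D, hB, fun x hxi hxg y hy => h x y hxi hxg ?_ fun a => hQ a x y hy⟩
      rintro rfl
      obtain ⟨i, hi⟩ := hy.1.1
      exact hi.ne_zero rfl
    · have h1 := aeval_algebraMap_apply K x g
      rw [aeval_eq_eval, h0, map_zero] at h1
      exact h1
  obtain ⟨T, hT, hTspan⟩ := (Submodule.fg_span_iff_fg_span_finset_subset Good).mp
    (IsNoetherian.noetherian (Ideal.span Good))
  have hTx : ∀ x ∈ ringPoints k SX F, ∃ g ∈ T, eval x g ≠ 0 := by
    intro x hx
    by_contra! h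
    obtain ⟨g, hg, hgx⟩ := hgood x hx
    have hle : Ideal.span (T : Set (MvPolynomial (Fin (n + 1)) F)) ≤ RingHom.ker (eval x) :=
      Ideal.span_le.mpr fun g hg => h g hg
    exact hgx (hle (hTspan.le (Ideal.subset_span hg)))
  choose! B D hB hBD using fun g (hg : g ∈ Good) => hg
  refine ⟨1 + ∑ g ∈ T, ∑ i, B g i, ∑ g ∈ T, ∑ i, D g i, ?_, fun x hx y hy => ?_⟩
  · exact le_add_of_nonneg_right (Finset.sum_nonneg fun g hg => Finset.sum_nonneg fun i _ =>
      zero_le_one.trans (hB g (hT hg) i))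
  · obtain ⟨i, hi⟩ := hx.1
    have hu : ∀ u : Fˣ, Height.mulHeight (fun j => (u : F) * x j) = Height.mulHeight x := fun u =>
      Height.mulHeight_smul_eq_mulHeight x u.ne_zero
    obtain ⟨g, hg, hgx⟩ := hTx _ (mul_mem_ringPoints hSX hx hi.unit⁻¹)
    have hy' : y ∈ fiberOver k Φ SY F (fun j => ((hi.unit⁻¹ : Fˣ) : F) * x j) := by
      obtain ⟨hy, c, hc, h⟩ := hy
      exact ⟨hy, c, hc, h.trans ⟨_, rfl⟩⟩
    have := hBD g (hT hg) i _ (by simp [hi.ne_zero]) hgx y hy'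
    rw [hu] at this
    refine this.trans (mul_le_mul ?_ (pow_le_pow_right₀ (Height.one_le_mulHeight x) ?_)
      (pow_nonneg (Height.mulHeight_pos x).le _) ?_)
    · refine le_add_of_nonneg_of_le zero_le_one ?_
      refine (Finset.single_le_sum (f := B g) (fun i _ => zero_le_one.trans (hB g (hT hg) i))
        (Finset.mem_univ i)).trans ?_
      exact Finset.single_le_sum (f := fun g => ∑ i, B g i) (fun g hg => Finset.sum_nonneg fun i _
          =>
        zero_le_one.trans (hB g (hT hg) i)) hg
    · refine (Finset.single_le_sum (f := D g) (fun i _ => Nat.zero_le _) (Finset.mem_univ i)).trans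
          ?_
      exact Finset.single_le_sum (f := fun g => ∑ i, D g i) (fun g hg => Nat.zero_le _) hg
    · exact add_nonneg zero_le_one (Finset.sum_nonneg fun g hg => Finset.sum_nonneg fun i _ =>
        zero_le_one.trans (hB g (hT hg) i))

end HeightBound

namespace NumberField

section Heights

variable {K : Type} [Field K] [NumberField K]

theorem InfinitePlace.prod_pow_mult_eq_prod_norm {ι : Type*} [Finite ι] (x : ι → K) :
    ∏ w : InfinitePlace K, (⨆ i, w (x i)) ^ w.mult = ∏ φ : K →+* ℂ, ⨆ i, ‖φ (x i)‖ := by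
  classical
  rw [← Finset.prod_fiberwise Finset.univ InfinitePlace.mk (fun φ : K →+* ℂ => ⨆ i, ‖φ (x i)‖)]
  refine Finset.prod_congr rfl fun w _ => ?_
  have h : ∀ φ ∈ ({φ | InfinitePlace.mk φ = w} : Finset (K →+* ℂ)),
      ⨆ i, ‖φ (x i)‖ = ⨆ i, w (x i) := fun φ hφ => by
    rw [← (Finset.mem_filter.mp hφ).2]
    rfl
  rw [Finset.prod_congr rfl h, Finset.prod_const, InfinitePlace.card_filter_mk_eq]

theorem sum_spanSingleton_eq_coeIdeal {N : ℕ} (z : Fin N → 𝓞 K) :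
    ∑ i, FractionalIdeal.spanSingleton (nonZeroDivisors (𝓞 K)) (algebraMap (𝓞 K) K (z i)) =
      ((Ideal.span (Set.range z) : Ideal (𝓞 K)) : FractionalIdeal (nonZeroDivisors (𝓞 K)) K) := by
  simp only [← FractionalIdeal.coeIdeal_span_singleton]
  change ∑ i, FractionalIdeal.coeIdealHom (nonZeroDivisors (𝓞 K)) K (Ideal.span {z i}) =
    FractionalIdeal.coeIdealHom (nonZeroDivisors (𝓞 K)) K _
  rw [← map_sum, Ideal.sum_eq_sup, Finset.sup_univ_eq_iSup, Ideal.span_range_eq_iSup]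

theorem exists_eq_smul_algebraMap {N : ℕ} (x : Fin N → K) :
    ∃ (c : K) (z : Fin N → 𝓞 K), c ≠ 0 ∧ x = c • (algebraMap (𝓞 K) K ∘ z) := by
  obtain ⟨b, hb⟩ := IsLocalization.exist_integer_multiples_of_finite (nonZeroDivisors (𝓞 K)) x
  choose z hz using hb
  have hb0 : algebraMap (𝓞 K) K b ≠ 0 :=
    IsFractionRing.to_map_ne_zero_of_mem_nonZeroDivisors b.2
  refine ⟨(algebraMap (𝓞 K) K b)⁻¹, z, inv_ne_zero hb0, funext fun i => ?_⟩
  simp only [Pi.smul_apply, Function.comp_apply, hz, smul_eq_mul]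
  rw [Algebra.smul_def, inv_mul_cancel_left₀ hb0]

theorem mulHeight_algebraMap_comp {N : ℕ} {z : Fin N → 𝓞 K} (hz : z ≠ 0) :
    Height.mulHeight (algebraMap (𝓞 K) K ∘ z) =
      ((Ideal.absNorm (Ideal.span (Set.range z)) : ℕ) : ℝ)⁻¹ *
        ∏ φ : K →+* ℂ, ⨆ i, ‖φ (algebraMap (𝓞 K) K (z i))‖ := by
  have hz' : algebraMap (𝓞 K) K ∘ z ≠ 0 := by
    obtain ⟨i, hi⟩ := Function.ne_iff.mp hz
    exact Function.ne_iff.mpr ⟨i, (map_ne_zero_iff _ (FaithfulSMul.algebraMap_injective _ _)).mpr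
        hi⟩
  rw [mulHeight_eq hz', InfinitePlace.prod_pow_mult_eq_prod_norm, mul_comm]
  congr 1
  exact eq_inv_of_mul_eq_one_right (absNorm_mul_finprod_finitePlace_eq_one hz)

theorem vecHeight_smul {N : ℕ} (x : Fin N → K) {c : K} (hc : c ≠ 0) :
    vecHeight (c • x) = vecHeight x := by
  have h1 : ∑ i, FractionalIdeal.spanSingleton (nonZeroDivisors (𝓞 K)) ((c • x) i) =
      FractionalIdeal.spanSingleton (nonZeroDivisors (𝓞 K)) c *
        ∑ i, FractionalIdeal.spanSingleton (nonZeroDivisors (𝓞 K)) (x i) := by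
    simp [Finset.mul_sum, FractionalIdeal.spanSingleton_mul_spanSingleton]
  have h2 : ∏ w : InfinitePlace K, (⨆ i, w ((c • x) i)) ^ w.mult =
      |((Algebra.norm ℚ c : ℚ) : ℝ)| * ∏ w : InfinitePlace K, (⨆ i, w (x i)) ^ w.mult := by
    rw [← Rat.cast_abs, ← InfinitePlace.prod_eq_abs_norm, ← Finset.prod_mul_distrib]
    refine Finset.prod_congr rfl fun w _ => ?_
    rw [← mul_pow, Real.mul_iSup_of_nonneg (apply_nonneg w c)]
    simp
  have hN : |((Algebra.norm ℚ c : ℚ) : ℝ)| ≠ 0 := by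
    rw [abs_ne_zero, Rat.cast_ne_zero]
    exact Algebra.norm_ne_zero_iff.mpr hc
  unfold vecHeight
  rw [h1, h2, map_mul, FractionalIdeal.absNorm_span_singleton]
  congr 1
  push_cast
  field_simp

/-- The absolute height defined by ideal norms is the normalized multiplicative height of
Mathlib. -/
theorem vecHeight_eq_mulHeight_rpow {N : ℕ} {x : Fin N → K} (hx : x ≠ 0) :
    vecHeight x = Height.mulHeight x ^ ((Module.finrank ℚ K : ℝ)⁻¹) := by
  obtain ⟨c, z, hc, rfl⟩ := exists_eq_smul_algebraMap x
  have hz : z ≠ 0 := by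
    rintro rfl
    exact hx (by ext; simp)
  rw [vecHeight_smul _ hc, Height.mulHeight_smul_eq_mulHeight _ hc, mulHeight_algebraMap_comp hz]
  unfold vecHeight
  rw [← InfinitePlace.prod_pow_mult_eq_prod_norm]
  simp only [Function.comp_apply]
  rw [sum_spanSingleton_eq_coeIdeal, FractionalIdeal.coeIdeal_absNorm]
  simp

theorem projHeight_mk {N : ℕ} {x : Fin (N + 1) → K} (hx : x ≠ 0) :
    projHeight (Projectivization.mk K x hx) =
      Height.mulHeight x ^ ((Module.finrank ℚ K : ℝ)⁻¹) := by
  obtain ⟨a, ha⟩ := Projectivization.exists_smul_eq_mk_rep K x hx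
  rw [projHeight, vecHeight_eq_mulHeight_rpow (Projectivization.rep_nonzero _), ← ha]
  congr 1
  exact Height.mulHeight_smul_eq_mulHeight x a.ne_zero

theorem card_embeddings_comp_algebraMap_eq {L : Type} [Field L] [NumberField L] [Algebra K L]
    (ψ : K →+* ℂ) :
    Nat.card {φ : L →+* ℂ // φ.comp (algebraMap K L) = ψ} = Module.finrank K L := by
  let : Algebra K ℂ := ψ.toAlgebra
  rw [← AlgHom.card K L ℂ, ← Nat.card_eq_fintype_card]
  let e : {φ : L →+* ℂ // φ.comp (algebraMap K L) = ψ} ≃ (L →ₐ[K] ℂ) :=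
    { toFun := fun φ => { φ.1 with commutes' := fun r => RingHom.congr_fun φ.2 r }
      invFun := fun φ => ⟨φ, φ.comp_algebraMap⟩
      left_inv := fun _ => rfl
      right_inv := fun _ => rfl }
  exact Nat.card_congr e

theorem prod_embeddings_comp_algebraMap {L : Type} [Field L] [NumberField L] [Algebra K L]
    (g : (K →+* ℂ) → ℝ) : ∏ φ : L →+* ℂ, g (φ.comp (algebraMap K L)) =
      (∏ ψ : K →+* ℂ, g ψ) ^ Module.finrank K L := by
  classical
  rw [← Finset.prod_fiberwise Finset.univ fun φ : L →+* ℂ => φ.comp (algebraMap K L),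
    ← Finset.prod_pow]
  refine Finset.prod_congr rfl fun ψ _ => ?_
  rw [← card_embeddings_comp_algebraMap_eq (L := L) ψ, Nat.card_eq_fintype_card,
      Fintype.card_subtype]
  exact Finset.prod_eq_pow_card fun φ hφ => by rw [(Finset.mem_filter.mp hφ).2]

theorem mulHeight_algebraMap {L : Type} [Field L] [NumberField L] [Algebra K L] {N : ℕ}
    (x : Fin N → K) : Height.mulHeight (algebraMap K L ∘ x) =
      Height.mulHeight x ^ Module.finrank K L := by
  rcases eq_or_ne x 0 with rfl | hx
  · have : (algebraMap K L ∘ (0 : Fin N → K)) = 0 := by ext; simp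
    rw [this]
    simp
  obtain ⟨c, z, hc, rfl⟩ := exists_eq_smul_algebraMap x
  have hz : z ≠ 0 := by
    rintro rfl
    exact hx (by ext; simp)
  have hz' : algebraMap (𝓞 K) (𝓞 L) ∘ z ≠ 0 := by
    obtain ⟨i, hi⟩ := Function.ne_iff.mp hz
    exact Function.ne_iff.mpr ⟨i, (map_ne_zero_iff _ (FaithfulSMul.algebraMap_injective _ _)).mpr
        hi⟩
  have h1 : algebraMap K L ∘ (c • (algebraMap (𝓞 K) K ∘ z)) =
      algebraMap K L c • (algebraMap (𝓞 L) L ∘ (algebraMap (𝓞 K) (𝓞 L) ∘ z)) := by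
    ext i
    simp only [Function.comp_apply, Pi.smul_apply, smul_eq_mul, map_mul,
      ← IsScalarTower.algebraMap_apply]
  have hspan : Ideal.span (Set.range (algebraMap (𝓞 K) (𝓞 L) ∘ z)) =
      (Ideal.span (Set.range z)).map (algebraMap (𝓞 K) (𝓞 L)) := by
    rw [Ideal.map_span, Set.range_comp]
  have hrank : Module.finrank (𝓞 K) (𝓞 L) = Module.finrank K L :=
    (IsFractionRing.finrank_eq (𝓞 K) K (𝓞 L) L).symm
  have hemb : ∏ φ : L →+* ℂ, ⨆ i, ‖φ (algebraMap (𝓞 L) L (algebraMap (𝓞 K) (𝓞 L) (z i)))‖ =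
      (∏ φ : K →+* ℂ, ⨆ i, ‖φ (algebraMap (𝓞 K) K (z i))‖) ^ Module.finrank K L := by
    simp only [← IsScalarTower.algebraMap_apply (𝓞 K) (𝓞 L) L,
      IsScalarTower.algebraMap_apply (𝓞 K) K L]
    exact prod_embeddings_comp_algebraMap fun ψ => ⨆ i, ‖ψ (algebraMap (𝓞 K) K (z i))‖
  rw [h1, Height.mulHeight_smul_eq_mulHeight _ hc,
    Height.mulHeight_smul_eq_mulHeight _ ((map_ne_zero _).mpr hc),
    mulHeight_algebraMap_comp hz, mulHeight_algebraMap_comp hz', hspan,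
    Ideal.absNorm_algebraMap, hrank, mul_pow, inv_pow, Nat.cast_pow]
  exact congrArg _ hemb

end Heights

end NumberField

/-- Sparsity is inherited along an injection that distorts heights at most polynomially. -/
theorem IsSparseWrt.of_injOn {P Q : Type} {S : Set P} {S' : Set Q} {H : P → ℝ} {H' : Q → ℝ}
    (hS' : IsSparseWrt S' H') (f : P → Q) (hf : Set.MapsTo f S S') (hinj : Set.InjOn f S)
    {B : ℝ} {D : ℕ} (hB : 1 ≤ B) (hH : ∀ x, 0 ≤ H x) (hle : ∀ x ∈ S, H' (f x) ≤ B * H x ^ D) :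
    IsSparseWrt S H := by
  intro ε hε
  have hD : (0 : ℝ) < D + 1 := by positivity
  have hB0 : 0 < B := zero_lt_one.trans_le hB
  obtain ⟨C, hC, h⟩ := hS' (ε / (D + 1)) (div_pos hε hD)
  refine ⟨C * B ^ (ε / (D + 1)), by positivity, fun T hT => ?_⟩
  have hT0 : 0 < T := zero_lt_one.trans_le hT
  obtain ⟨hfin, hcard⟩ := h (B * T ^ D) (one_le_mul_of_one_le_of_one_le hB (one_le_pow₀ hT))
  have hmaps : Set.MapsTo f {x | x ∈ S ∧ H x ≤ T} {y | y ∈ S' ∧ H' y ≤ B * T ^ D} :=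
    fun x hx => ⟨hf hx.1, (hle x hx.1).trans
      (mul_le_mul_of_nonneg_left (pow_le_pow_left₀ (hH x) hx.2 D) hB0.le)⟩
  have hinj' : Set.InjOn f {x | x ∈ S ∧ H x ≤ T} := hinj.mono fun x hx => hx.1
  refine ⟨Set.Finite.of_injOn hmaps hinj' hfin, ?_⟩
  refine (Nat.cast_le.mpr (Set.ncard_le_ncard_of_injOn f hmaps hinj' hfin)).trans (hcard.trans ?_)
  rw [Real.mul_rpow hB0.le (by positivity), ← mul_assoc, ← Real.rpow_natCast, ← Real.rpow_mul
      hT0.le]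
  refine mul_le_mul_of_nonneg_left (Real.rpow_le_rpow_of_exponent_le hT ?_) (by positivity)
  rw [mul_div_assoc', div_le_iff₀ hD]
  nlinarith

section ProjectivePoints

variable {k F : Type} [Field k] [Field F] [Algebra k F] {m n : ℕ}

theorem rep_mem_ringPoints_iff {S : Set (MvPolynomial (Fin (n + 1)) k)}
    {P : Projectivization F (Fin (n + 1) → F)} :
    P.rep ∈ ringPoints k S F ↔ P ∈ projZeroLocus k S F := by
  refine ⟨fun h => h.2, fun h => ⟨?_, h⟩⟩
  obtain ⟨i, hi⟩ := Function.ne_iff.mp P.rep_nonzero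
  exact ⟨i, isUnit_iff_ne_zero.mpr hi⟩

theorem mk_mem_projZeroLocus_iff {S : Set (MvPolynomial (Fin (n + 1)) k)}
    (hS : ∀ f ∈ S, ∃ e, f.IsHomogeneous e) {x : Fin (n + 1) → F} (hx : x ≠ 0) :
    Projectivization.mk F x hx ∈ projZeroLocus k S F ↔ x ∈ ringPoints k S F := by
  obtain ⟨a, ha⟩ := Projectivization.exists_smul_eq_mk_rep F x hx
  rw [← rep_mem_ringPoints_iff, ← ha]
  refine ⟨fun h => ?_, fun h => mul_mem_ringPoints hS h a⟩
  convert mul_mem_ringPoints hS h a⁻¹ using 1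
  ext i
  simp [Units.smul_def]

theorem comp_mem_ringPoints_iff {F' : Type} [Field F'] [Algebra k F']
    {S : Set (MvPolynomial (Fin (n + 1)) k)} {x : Fin (n + 1) → F} (g : F →ₐ[k] F') :
    g ∘ x ∈ ringPoints k S F' ↔ x ∈ ringPoints k S F := by
  refine ⟨fun h => ?_, fun h => comp_mem_ringPoints h g⟩
  obtain ⟨⟨i, hi⟩, h⟩ := h
  refine ⟨⟨i, isUnit_iff_ne_zero.mpr fun h0 => hi.ne_zero (by simp [h0])⟩, fun f hf => ?_⟩
  have := h f hf
  rw [eval_map, ← aeval_def] at this ⊢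
  have h1 := comp_aeval_apply (f := x) g f
  exact g.toRingHom.injective (h1.trans (this.trans (map_zero g).symm))

theorem chartImage_mk_mk {SY : Set (MvPolynomial (Fin (m + 1)) k)} {Φ : ChartMap k m n}
    (hS : ∀ f ∈ SY, ∃ e, f.IsHomogeneous e) {y : Fin (m + 1) → F} {x : Fin (n + 1) → F}
    (hy : y ∈ fiberOver k Φ SY F x) (hy0 : y ≠ 0) (hx0 : x ≠ 0) :
    chartImage Φ (Projectivization.mk F y hy0) (Projectivization.mk F x hx0) := by
  obtain ⟨a, ha⟩ := Projectivization.exists_smul_eq_mk_rep F y hy0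
  have h := mul_mem_fiberOver hS hy a
  change a • y ∈ _ at h
  rw [ha] at h
  obtain ⟨-, c, ⟨i, hi⟩, u, hu⟩ := h
  refine ⟨c, fun h0 => hi.ne_zero (congrFun h0 i), ?_⟩
  rw [Projectivization.mk_eq_mk_iff]
  exact ⟨u, hu.symm⟩

theorem ne_zero_of_mem_ringPoints {S : Set (MvPolynomial (Fin (n + 1)) k)}
    {x : Fin (n + 1) → F} (hx : x ∈ ringPoints k S F) : x ≠ 0 := by
  rintro rfl
  obtain ⟨i, hi⟩ := hx.1
  exact hi.ne_zero rfl

theorem IsChartMorphism.eq_of_mem_fiberOver {SY : Set (MvPolynomial (Fin (m + 1)) k)}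
    {SX : Set (MvPolynomial (Fin (n + 1)) k)} {Φ : ChartMap k m n} (hSY : ∀ f ∈ SY, ∃ e,
        f.IsHomogeneous e)
    (hmor : IsChartMorphism k Φ SY SX) {F' : Type} [Field F'] [Algebra k F'] (g : F →ₐ[k] F')
    {P Q : Projectivization F (Fin (n + 1) → F)} {y z : Fin (m + 1) → F'}
    (hy : y ∈ fiberOver k Φ SY F' (g ∘ P.rep)) (hz : z ∈ fiberOver k Φ SY F' (g ∘ Q.rep))
    (hyz : unitEquiv y z) : P = Q := by
  obtain ⟨u, rfl⟩ := hyz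
  obtain ⟨-, c, hc, h⟩ := mul_mem_fiberOver hSY hy u
  obtain ⟨hz, c', hc', h'⟩ := hz
  have hPQ := (h.symm.trans (hmor.compat F' _ hz c c' hc hc')).trans h'
  obtain ⟨i, hi⟩ := Function.ne_iff.mp P.rep_nonzero
  obtain ⟨v, hv⟩ := hPQ
  have hQ : Q.rep i ≠ 0 := fun h0 => by
    have := congrFun hv i
    simp [h0] at this
    exact hi this
  obtain ⟨w, hw⟩ := unitEquiv_of_forall_mul_eq (isUnit_iff_ne_zero.mpr hi)
    (isUnit_iff_ne_zero.mpr hQ) fun j => g.toRingHom.injective (by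
      change g _ = g _
      have h1 := congrFun hv i
      have h2 := congrFun hv j
      simp only [Function.comp_apply] at h1 h2
      rw [map_mul, map_mul, h1, h2]
      ring)
  rw [← P.mk_rep, ← Q.mk_rep, eq_comm, Projectivization.mk_eq_mk_iff]
  exact ⟨w, hw.symm⟩

end ProjectivePoints

theorem projHeight_nonneg {F : Type} [Field F] [NumberField F] {n : ℕ}
    (P : Projectivization F (Fin (n + 1) → F)) : 0 ≤ projHeight P := by
  rw [← P.mk_rep, NumberField.projHeight_mk]
  exact Real.rpow_nonneg (Height.mulHeight_pos _).le _

theorem projHeight_mk_le {F F' : Type} [Field F] [NumberField F] [Field F'] [NumberField F']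
    [Algebra F F'] {m n : ℕ} {P : Projectivization F (Fin (n + 1) → F)} {y : Fin (m + 1) → F'}
    (hy : y ≠ 0) {B : ℝ} {D : ℕ} (hB : 1 ≤ B)
    (h : Height.mulHeight y ≤ B * Height.mulHeight (algebraMap F F' ∘ P.rep) ^ D) :
    projHeight (Projectivization.mk F' y hy) ≤ B * projHeight P ^ D := by
  have : FiniteDimensional F F' := Module.Finite.of_restrictScalars_finite ℚ F F'
  conv_rhs => rw [← P.mk_rep]
  rw [NumberField.projHeight_mk, NumberField.projHeight_mk]
  rw [NumberField.mulHeight_algebraMap] at h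
  have hB0 : 0 ≤ B := zero_le_one.trans hB
  have hP := (Height.mulHeight_pos P.rep).le
  refine (Real.rpow_le_rpow (Height.mulHeight_pos _).le h (by positivity)).trans ?_
  rw [Real.mul_rpow hB0 (by positivity)]
  have hq : (Module.finrank ℚ F' : ℝ) = Module.finrank ℚ F * Module.finrank F F' := by
    rw [← Nat.cast_mul, Module.finrank_mul_finrank]
  have he : (Module.finrank F F' : ℝ) ≠ 0 := Nat.cast_ne_zero.mpr Module.finrank_pos.ne'
  have heq : ((Height.mulHeight P.rep ^ Module.finrank F F') ^ D) ^ (Module.finrank ℚ F' : ℝ)⁻¹ =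
      (Height.mulHeight P.rep ^ (Module.finrank ℚ F : ℝ)⁻¹) ^ D := by
    rw [← Real.rpow_natCast, ← Real.rpow_natCast, ← Real.rpow_natCast, ← Real.rpow_mul hP,
      ← Real.rpow_mul hP, ← Real.rpow_mul hP, hq]
    congr 1
    field_simp
  rw [heq]
  refine mul_le_mul_of_nonneg_right ?_ (by positivity)
  calc B ^ (Module.finrank ℚ F' : ℝ)⁻¹ ≤ B ^ (1 : ℝ) :=
        Real.rpow_le_rpow_of_exponent_le hB
          (inv_le_one_of_one_le₀ (Nat.one_le_cast.mpr Module.finrank_pos))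
    _ = B := Real.rpow_one B

/-- Let `f : Y → X` be a morphism of projective geometrically
irreducible varieties over a number field `k` (realized as closed subvarieties of
projective spaces, the morphism being given by polynomial chart data `Φ`), and assume `f`
is finite étale over all of `X`.  Let `U = X ∖ Z(SU)` be a Zariski open subset of `X` and
`V = f⁻¹(U)`.  If `V` is xeric, then `U` is xeric. -/
theorem statement_5 (k : Type) [Field k] [NumberField k] (m n : ℕ)
    (SY : Set (MvPolynomial (Fin (m + 1)) k)) (SX SU : Set (MvPolynomial (Fin (n + 1)) k))
    (hSYhom : ∀ f ∈ SY, ∃ e, f.IsHomogeneous e)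
    (hSXhom : ∀ f ∈ SX, ∃ e, f.IsHomogeneous e)
    (hSUhom : ∀ f ∈ SU, ∃ e, f.IsHomogeneous e)
    (hYint : GeomIntegralOver k (AlgebraicClosure k) SY)
    (hXint : GeomIntegralOver k (AlgebraicClosure k) SX)
    (Φ : ChartMap k m n) (hmor : IsChartMorphism k Φ SY SX)
    (hetale : IsFiniteEtaleMor k Φ SY SX)
    (hV : ∀ (L : Type) [Field L] [NumberField L] [Algebra k L] [FiniteDimensional k L],
      IsSparseWrt
        {y | y ∈ projZeroLocus k SY L ∧
          ∃ x, chartImage Φ y x ∧ x ∈ projZeroLocus k SX L \ projZeroLocus k SU L}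
        projHeight) :
    ∀ (L : Type) [Field L] [NumberField L] [Algebra k L] [FiniteDimensional k L],
      IsSparseWrt (projZeroLocus k SX L \ projZeroLocus k SU L) projHeight := by
  intro L _ _ _ _
  classical
  obtain ⟨d, hd, hetale⟩ := hetale
  let K := AlgebraicClosure L
  have : Algebra.IsAlgebraic ℚ K := Algebra.IsAlgebraic.trans ℚ L K
  obtain ⟨L', hL', hpt⟩ := exists_finiteDimensional_forall_exists_mem_fiberOver (L := L) K hSYhom
    hmor hd hetale
  have : FiniteDimensional ℚ L' := Module.Finite.trans L L'
  have : NumberField L' := ⟨⟩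
  have : FiniteDimensional k L' := Module.Finite.trans L L'
  have : IsScalarTower k L' K := IsScalarTower.of_algebraMap_eq fun _ => rfl
  obtain ⟨B, D, hB, hheight⟩ := exists_forall_fiberOver_mulHeight_le (F := L') K hSYhom hSXhom
    hmor hetale
  choose! y hy using hpt
  let g : L →ₐ[k] L' := IsScalarTower.toAlgHom k L L'
  let S := projZeroLocus k SX L \ projZeroLocus k SU L
  have hyP : ∀ P ∈ S, y P.rep ∈ fiberOver k Φ SY L' (g ∘ P.rep) :=
    fun P hP => hy _ (rep_mem_ringPoints_iff.mpr hP.1)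
  have hgP : ∀ P ∈ S, g ∘ P.rep ∈ ringPoints k SX L' :=
    fun P hP => comp_mem_ringPoints (rep_mem_ringPoints_iff.mpr hP.1) g
  have hy0 : ∀ P : S, y P.1.rep ≠ 0 := fun P => ne_zero_of_mem_ringPoints (hyP P P.2).1
  let f : Projectivization L (Fin (n + 1) → L) → Projectivization L' (Fin (m + 1) → L') :=
    fun P => if h : y P.rep ≠ 0 then Projectivization.mk L' (y P.rep) h else
      Projectivization.mk L' 1 one_ne_zero
  have hf : ∀ P (hP : P ∈ S), f P = Projectivization.mk L' (y P.rep) (hy0 ⟨P, hP⟩) :=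
    fun P hP => dif_pos (hy0 ⟨P, hP⟩)
  refine (hV L').of_injOn (D := D) f (fun P hP => ?_) (fun P hP Q hQ hPQ => ?_) hB projHeight_nonneg
    fun P hP => ?_
  · have hg0 := ne_zero_of_mem_ringPoints (hgP P hP)
    rw [hf P hP]
    refine ⟨(mk_mem_projZeroLocus_iff hSYhom _).mpr (hyP P hP).1, Projectivization.mk L' _ hg0,
      chartImage_mk_mk hSYhom (hyP P hP) _ _,
      (mk_mem_projZeroLocus_iff hSXhom _).mpr (hgP P hP), fun h => hP.2 ?_⟩
    rwa [mk_mem_projZeroLocus_iff hSUhom, comp_mem_ringPoints_iff, rep_mem_ringPoints_iff] at h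
  · rw [hf P hP, hf Q hQ, eq_comm, Projectivization.mk_eq_mk_iff] at hPQ
    obtain ⟨u, hu⟩ := hPQ
    exact hmor.eq_of_mem_fiberOver hSYhom g (hyP P hP) (hyP Q hQ) ⟨u, hu.symm⟩
  · rw [hf P hP]
    exact projHeight_mk_le _ hB (hheight _ (hgP P hP) _ (hyP P hP))
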